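/- arXiv:0811.2389 — 2 statements merged into one kernel-verified Lean document; each statement's English description precedes it below -/
import Mathlib

section
/- Let G be a finitely generated group, E an admissible family of subgroups of G, and T a minimal E-tree with more than one cylinder in which every vertex has valence at least 3. Let S = S_{u,Y} be a peripheral special forest and S' a non-trivial special forest with [[S']] ≠ [[S]]. (1) If S' ⊆ S, then Φ([[S']]) belongs to the connected component of T_c ∖ {Φ([[S]])} which contains u_c. (2) If S ⊆ S', then Φ([[S']]) belongs to the connected component of T_c ∖ {Φ([[S]])} which does not contain u_c. -/
open scoped Pointwise symmDiff

namespace SSRN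

section Group
variable {G : Type*} [Group G]

/-- A subset of `G` is `H`-finite if it is contained in finitely many orbits of the
action of `H` on `G` by left multiplication. -/
def HFin (H : Subgroup G) (X : Set G) : Prop :=
  ∃ F : Finset G, X ⊆ ⋃ f ∈ F, (· * f) '' (H : Set G)

/-- Two subsets of `G` are `H`-equivalent if their symmetric difference is `H`-finite. -/
def AIEquiv (H : Subgroup G) (X Y : Set G) : Prop := HFin H (X ∆ Y)

/-- `X` is an `H`-almost invariant subset of `G`. -/
def IsAI (H : Subgroup G) (X : Set G) : Prop :=
  (∀ h ∈ H, (h * ·) '' X = X) ∧ ∀ s : G, HFin H (((· * s) '' X) ∆ X)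

/-- `X` is a non-trivial `H`-almost invariant subset of `G`. -/
def NontrivAI (H : Subgroup G) (X : Set G) : Prop :=
  IsAI H X ∧ ¬ HFin H X ∧ ¬ HFin H Xᶜ

/-- The `H`-almost invariant set `X` crosses `Y`: none of the four corners is `H`-finite. -/
def Crosses (H : Subgroup G) (X Y : Set G) : Prop :=
  ¬ HFin H (X ∩ Y) ∧ ¬ HFin H (X ∩ Yᶜ) ∧ ¬ HFin H (Xᶜ ∩ Y) ∧ ¬ HFin H (Xᶜ ∩ Yᶜ)

/-- Crossing of (non-trivial) almost invariant sets, quantifying over the groups over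
which they are almost invariant. -/
def CrossesAny (X X' : Set G) : Prop :=
  ∃ H K : Subgroup G, NontrivAI H X ∧ NontrivAI K X' ∧ Crosses H X X'

/-- `X` and `X'` determine the same unordered pair `{[X], [X*]}` of equivalence classes. -/
def SamePair (X X' : Set G) : Prop :=
  ∃ H : Subgroup G, NontrivAI H X ∧ (HFin H (X ∆ X') ∨ HFin H (X ∆ X'ᶜ))

/-- An admissible family of subgroups: conjugacy invariant, closed under commensurability,
and no member contains another with infinite index. -/
def Admissible (E : Set (Subgroup G)) : Prop :=
  (∀ H ∈ E, ∀ g : G, (MulAut.conj g • H) ∈ E) ∧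
  (∀ H ∈ E, ∀ K : Subgroup G, Subgroup.Commensurable K H → K ∈ E) ∧
  (∀ A ∈ E, ∀ B ∈ E, A ≤ B → A.relIndex B ≠ 0)

end Group

section Tree

variable {V : Type*}

/-- The stabilizer of an edge `e : Sym2 V` under the action of `G`. -/
def edgeStab (G : Type*) [Group G] [MulAction G V] (e : Sym2 V) : Subgroup G where
  carrier := {g | Sym2.map (g • ·) e = e}
  one_mem' := by
    show Sym2.map ((1 : G) • ·) e = e
    have : ((1 : G) • · : V → V) = id := by funext v; simp
    rw [this, Sym2.map_id]; rfl
  mul_mem' := by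
    intro a b ha hb
    show Sym2.map ((a * b) • ·) e = e
    have : ((a * b) • · : V → V) = (a • ·) ∘ (b • ·) := by funext v; simp [mul_smul]
    rw [this, ← Sym2.map_map, hb, ha]
  inv_mem' := by
    intro a ha
    show Sym2.map (a⁻¹ • ·) e = e
    conv_lhs => rw [← ha]
    rw [Sym2.map_map]
    have : ((a⁻¹ • ·) ∘ (a • ·) : V → V) = id := by funext v; simp
    rw [this, Sym2.map_id]; rfl

variable (T : SimpleGraph V)

/-- `G` acts on the graph `T` by graph automorphisms. -/
def ActsOn (G : Type*) [Group G] [MulAction G V] : Prop :=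
  ∀ (g : G) (u v : V), T.Adj u v → T.Adj (g • u) (g • v)

/-- The action of `G` on `T` is without inversions. -/
def NoInversions (G : Type*) [Group G] [MulAction G V] : Prop :=
  ∀ (g : G) (u v : V), T.Adj u v → ¬ (g • u = v ∧ g • v = u)

/-- `w` lies between `u` and `v`: it is on every path from `u` to `v`. -/
def Btw (u w v : V) : Prop := ∀ p : T.Walk u v, p.IsPath → w ∈ p.support

/-- The action of `G` on the tree `T` is minimal: every nonempty invariant subtree
(convex invariant set of vertices) is the whole vertex set. -/
def MinimalAction (G : Type*) [Group G] [MulAction G V] : Prop :=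
  ∀ A : Set V, A.Nonempty → (∀ (g : G), ∀ a ∈ A, g • a ∈ A) →
    (∀ u ∈ A, ∀ v ∈ A, ∀ w : V, Btw T u w v → w ∈ A) → A = Set.univ

/-- The action of `G` is non-trivial: there is no global fixed vertex. -/
def NontrivialAction (G : Type*) [Group G] [MulAction G V] : Prop :=
  ¬ ∃ v : V, ∀ g : G, g • v = v

/-- `T` is an `E`-tree: all edge stabilizers belong to `E`. -/
def IsETree (G : Type*) [Group G] [MulAction G V] (E : Set (Subgroup G)) : Prop :=
  ∀ e ∈ T.edgeSet, edgeStab G e ∈ E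

/-- There are finitely many `G`-orbits of edges. -/
def FinEdgeOrbits (G : Type*) [Group G] [MulAction G V] : Prop :=
  ∃ F : Finset (Sym2 V), ∀ e ∈ T.edgeSet, ∃ e₀ ∈ F, ∃ g : G, Sym2.map (g • ·) e₀ = e

/-- A cylinder of `T`: an equivalence class of edges for commensurability of stabilizers. -/
def IsCylinder (G : Type*) [Group G] [MulAction G V] (Y : Set (Sym2 V)) : Prop :=
  Y.Nonempty ∧ Y ⊆ T.edgeSet ∧
    ∀ e ∈ Y, ∀ e' ∈ T.edgeSet,
      (e' ∈ Y ↔ Subgroup.Commensurable (edgeStab G e) (edgeStab G (V := V) e'))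

/-- The set of vertices of a set of edges (e.g. of a cylinder). -/
def cylVerts (Y : Set (Sym2 V)) : Set V := {v | ∃ e ∈ Y, v ∈ e}

/-- The boundary of a cylinder: its vertices lying in another cylinder,
i.e. incident to an edge outside the cylinder. -/
def cylBoundary (Y : Set (Sym2 V)) : Set V :=
  {v | v ∈ cylVerts Y ∧ ∃ e ∈ T.edgeSet, v ∈ e ∧ e ∉ Y}

/-- `H` belongs to the commensurability class associated to the cylinder `Y`. -/
def InClassOf (G : Type*) [Group G] [MulAction G V] (Y : Set (Sym2 V)) (H : Subgroup G) : Prop :=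
  ∃ e ∈ Y, Subgroup.Commensurable H (edgeStab G e)

/-- The coboundary of a set of vertices: edges with exactly one endpoint in it. -/
def cobdry (S : Set V) : Set (Sym2 V) :=
  {e | e ∈ T.edgeSet ∧ ∃ u v : V, e = s(u, v) ∧ u ∈ S ∧ v ∉ S}

/-- `S` is a special forest based on the cylinder `Y`. -/
def IsSpecialForest (S : Set V) (Y : Set (Sym2 V)) : Prop :=
  (cobdry T S).Finite ∧ cobdry T S ⊆ Y

/-- A set of vertices is non-trivial if it is neither finite nor cofinite. -/
def NontrivForest (S : Set V) : Prop := ¬ S.Finite ∧ ¬ (Sᶜ : Set V).Finite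

/-- The almost invariant set associated to a set of vertices. -/
def XS (G : Type*) [Group G] [MulAction G V] (v₀ : V) (S : Set V) : Set G :=
  {g : G | g • v₀ ∈ S}

/-- The component `T_e` of `T` minus the open edge `e = s(u,v)` containing the terminal
vertex `v`. -/
def halfTree (u v : V) : Set V :=
  {w | ∃ p : T.Walk v w, p.IsPath ∧ s(u, v) ∉ p.edges}

/-- The almost invariant set `Z_e` dual to the oriented edge `(u, v)`. -/
def Ze (G : Type*) [Group G] [MulAction G V] (v₀ u v : V) : Set G :=
  XS G v₀ (halfTree T u v)

/-- `v` has finitely many incident edges in `Y`. -/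
def FiniteValenceIn (Y : Set (Sym2 V)) (v : V) : Prop := {e | e ∈ Y ∧ v ∈ e}.Finite

/-- The peripheral special forest `S_{v,Y}`: the component of `v` in `T` minus the open
edges of `Y` incident to `v`. -/
def periForest (Y : Set (Sym2 V)) (v : V) : Set V :=
  {w | ∃ p : T.Walk v w, p.IsPath ∧ ∀ e ∈ Y, v ∈ e → e ∉ p.edges}

/-- The peripheral almost invariant set `X_{v,Y}`. -/
def XvY (G : Type*) [Group G] [MulAction G V] (v₀ : V) (Y : Set (Sym2 V)) (v : V) : Set G :=
  XS G v₀ (periForest T Y v)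

/-- A peripheral special forest: one equivalent to some `S_{v,Y}`. -/
def PeripheralForest (G : Type*) [Group G] [MulAction G V] (S : Set V) : Prop :=
  ∃ (Y : Set (Sym2 V)) (v : V), IsCylinder T G Y ∧ v ∈ cylBoundary T Y ∧
    FiniteValenceIn Y v ∧ (S ∆ periForest T Y v).Finite

/-- The Boolean algebra `B_C(T)` of (representatives of) almost invariant sets based on the
cylinder `Y`: the smallest family containing the sets `Z_e`, `e ∈ Y`, closed under
complement, intersection and `H`-equivalence. -/
def BCT {G : Type*} [Group G] [MulAction G V] (v₀ : V) (Y : Set (Sym2 V)) (H : Subgroup G) :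
    Set (Set G) :=
  ⋂₀ {F : Set (Set G) |
    (∀ u v : V, T.Adj u v → s(u, v) ∈ Y → Ze T G v₀ u v ∈ F) ∧
    (∀ X ∈ F, Xᶜ ∈ F) ∧
    (∀ X ∈ F, ∀ X' ∈ F, X ∩ X' ∈ F) ∧
    (∀ X ∈ F, ∀ X' : Set G, HFin H (X ∆ X') → X' ∈ F)}

/-- The set `B(T)` of (representatives of) almost invariant sets based on `T`. -/
def BT (G : Type*) [Group G] [MulAction G V] (v₀ : V) : Set (Set G) :=
  {X | ∃ Y : Set (Sym2 V), IsCylinder T G Y ∧ ∃ e ∈ Y, X ∈ BCT T v₀ Y (edgeStab G e)}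

/-- Elements of `B(T)` that are non-trivial almost invariant sets. -/
def NontrivB (G : Type*) [Group G] [MulAction G V] (v₀ : V) : Set (Set G) :=
  {X | X ∈ BT T G v₀ ∧ ∃ H : Subgroup G, NontrivAI H X}

/-- One step of the relation generating cross-connected components. -/
def ccStep (G : Type*) [Group G] [MulAction G V] (v₀ : V) (X X' : Set G) : Prop :=
  X ∈ NontrivB T G v₀ ∧ X' ∈ NontrivB T G v₀ ∧ (CrossesAny X X' ∨ SamePair X X')

/-- The equivalence relation generated by crossing (and identification of equivalent sets
and complements) on `B(T)`. -/
def ccRel (G : Type*) [Group G] [MulAction G V] (v₀ : V) : Set G → Set G → Prop :=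
  Relation.EqvGen (ccStep T G v₀)

/-- The cross-connected component of (the pair determined by) `X`. -/
def ccOf (G : Type*) [Group G] [MulAction G V] (v₀ : V) (X : Set G) : Set (Set G) :=
  {X' | ccRel T G v₀ X X'}

/-- `C` is a cross-connected component of `B(T)`. -/
def IsCCC (G : Type*) [Group G] [MulAction G V] (v₀ : V) (C : Set (Set G)) : Prop :=
  ∃ X ∈ NontrivB T G v₀, C = ccOf T G v₀ X

/-- A cross-connected component is based on the cylinder `Y` if its members are almost
invariant over subgroups in the commensurability class of `Y`. -/
def CCCBasedOn (G : Type*) [Group G] [MulAction G V] (Y : Set (Sym2 V)) (C : Set (Set G)) :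
    Prop :=
  ∃ X ∈ C, ∃ H : Subgroup G, InClassOf G Y H ∧ NontrivAI H X

/-- A peripheral cross-connected component. -/
def PeripheralCCC (G : Type*) [Group G] [MulAction G V] (v₀ : V) (C : Set (Set G)) : Prop :=
  ∃ (Y : Set (Sym2 V)) (v : V), IsCylinder T G Y ∧ v ∈ cylBoundary T Y ∧
    FiniteValenceIn Y v ∧ XvY T G v₀ Y v ∈ C

/-- Betweenness of (distinct) cross-connected components. -/
def CCCBetween {G : Type*} [Group G] (C₁ C₂ C₃ : Set (Set G)) : Prop :=
  C₁ ≠ C₂ ∧ C₂ ≠ C₃ ∧ C₁ ≠ C₃ ∧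
    ∃ X₁ ∈ C₁, ∃ X₂ ∈ C₂, ∃ X₃ ∈ C₃, X₁ ⊆ X₂ ∧ X₂ ⊆ X₃

/-- A star of cross-connected components. -/
def IsStar (G : Type*) [Group G] [MulAction G V] (v₀ : V) (St : Set (Set (Set G))) : Prop :=
  (∀ C ∈ St, IsCCC T G v₀ C) ∧ St.Nontrivial ∧
  (∀ C ∈ St, ∀ C' ∈ St, ∀ C'' : Set (Set G), IsCCC T G v₀ C'' → ¬ CCCBetween C C'' C') ∧
  (∀ St' : Set (Set (Set G)), St ⊆ St' → (∀ C ∈ St', IsCCC T G v₀ C) →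
    (∀ C ∈ St', ∀ C' ∈ St', ∀ C'' : Set (Set G), IsCCC T G v₀ C'' → ¬ CCCBetween C C'' C') →
    St' = St)

/-- The regular neighbourhood `RN(B(T))`: the bipartite graph on cross-connected
components and stars. -/
def RNGraph (G : Type*) [Group G] [MulAction G V] (v₀ : V) :
    SimpleGraph ({C : Set (Set G) // IsCCC T G v₀ C} ⊕
      {St : Set (Set (Set G)) // IsStar T G v₀ St}) where
  Adj x y :=
    match x, y with
    | Sum.inl C, Sum.inr St => C.1 ∈ St.1
    | Sum.inr St, Sum.inl C => C.1 ∈ St.1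
    | _, _ => False
  symm := ⟨by rintro (C | St) (C' | St') h <;> exact h⟩
  loopless := ⟨by rintro (C | St) h <;> exact h⟩

/-- Vertices of `T` lying in at least two cylinders. -/
def TcV0 (G : Type*) [Group G] [MulAction G V] : Set V :=
  {v | ∃ Y Y' : Set (Sym2 V), IsCylinder T G Y ∧ IsCylinder T G Y' ∧ Y ≠ Y' ∧
    v ∈ cylVerts Y ∧ v ∈ cylVerts Y'}

/-- The tree of cylinders `T_c` of `T`, as a bipartite graph. -/
def TcGraph (G : Type*) [Group G] [MulAction G V] :
    SimpleGraph ({v : V // v ∈ TcV0 T G} ⊕ {Y : Set (Sym2 V) // IsCylinder T G Y}) where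
  Adj x y :=
    match x, y with
    | Sum.inl v, Sum.inr Y => v.1 ∈ cylVerts Y.1
    | Sum.inr Y, Sum.inl v => v.1 ∈ cylVerts Y.1
    | _, _ => False
  symm := ⟨by rintro (v | Y) (v' | Y') h <;> exact h⟩
  loopless := ⟨by rintro (v | Y) h <;> exact h⟩


/-- `T` dominates `T'`: there is a `G`-equivariant map. -/
def Dominates (G : Type*) [Group G] {V V' : Type*} [MulAction G V] [MulAction G V']
    (T : SimpleGraph V) (T' : SimpleGraph V') : Prop :=
  ∃ f : V → V', ∀ (g : G) (x : V), f (g • x) = g • f x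

end Tree

section Subdiv

variable {α β : Type*}

/-- `S` is a subdivision of `Γ` via the vertex embedding `f`. -/
def SubdivVia (f : α → β) (S : SimpleGraph β) (Γ : SimpleGraph α) : Prop :=
  Function.Injective f ∧
  (∀ b : β, b ∉ Set.range f → ∃ x y : β, x ≠ y ∧ S.neighborSet b = {x, y}) ∧
  (∀ u : α, Nonempty (Γ.neighborSet u ≃ S.neighborSet (f u))) ∧
  (∀ u v : α, Γ.Adj u v ↔ ∃ p : S.Walk (f u) (f v), p.IsPath ∧ 1 ≤ p.length ∧
      ∀ w ∈ p.support, w ∈ Set.range f → w = f u ∨ w = f v) ∧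
  (∀ e ∈ S.edgeSet, ∃ (u v : α) (p : S.Walk (f u) (f v)), Γ.Adj u v ∧ p.IsPath ∧
      (∀ w ∈ p.support, w ∈ Set.range f → w = f u ∨ w = f v) ∧ e ∈ p.edges)

/-- `S` is (isomorphic to) a subdivision of `Γ`. -/
def IsSubdivision (S : SimpleGraph β) (Γ : SimpleGraph α) : Prop :=
  ∃ f : α → β, SubdivVia f S Γ

end Subdiv

end SSRN

namespace SSRN

/-- Vertices of the subdivided tree of cylinders: vertices of `T`, cylinders, and
midpoints of edges `(v, Y)`. -/
def TcSubV (V : Type*) := V ⊕ (Set (Sym2 V) ⊕ (V × Set (Sym2 V)))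

variable {V : Type*}

/-- The vertex of the subdivided tree of cylinders corresponding to a vertex of `T`. -/
def tcv (v : V) : TcSubV V := Sum.inl v

/-- The vertex of the subdivided tree of cylinders corresponding to a cylinder. -/
def tcY (Y : Set (Sym2 V)) : TcSubV V := Sum.inr (Sum.inl Y)

/-- The midpoint of the edge `(v_c, Y_c)`. -/
def tcMid (v : V) (Y : Set (Sym2 V)) : TcSubV V := Sum.inr (Sum.inr (v, Y))

variable (T : SimpleGraph V)

/-- `(v, Y)` is an edge of the tree of cylinders. -/
def MidOK (G : Type*) [Group G] [MulAction G V] (v : V) (Y : Set (Sym2 V)) : Prop :=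
  IsCylinder T G Y ∧ v ∈ cylBoundary T Y

/-- Half of the adjacency relation of the subdivided tree of cylinders. -/
def TcHalfAdj (G : Type*) [Group G] [MulAction G V] (x y : TcSubV V) : Prop :=
  (∃ (v : V) (Y : Set (Sym2 V)), MidOK T G v Y ∧ x = tcv v ∧ y = tcMid v Y) ∨
  (∃ (v : V) (Y : Set (Sym2 V)), MidOK T G v Y ∧ x = tcY Y ∧ y = tcMid v Y)

/-- The subdivided tree of cylinders (each edge `(v_c, Y_c)` carries a midpoint). -/
def TcSub (G : Type*) [Group G] [MulAction G V] : SimpleGraph (TcSubV V) where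
  Adj x y := x ≠ y ∧ (TcHalfAdj T G x y ∨ TcHalfAdj T G y x)
  symm := ⟨fun x y h => ⟨h.1.symm, h.2.symm⟩⟩
  loopless := ⟨fun x h => h.1 rfl⟩

/-- `|∂Y| ≥ 3`. -/
def BigBoundary (Y : Set (Sym2 V)) : Prop :=
  ∃ a b c : V, a ∈ cylBoundary T Y ∧ b ∈ cylBoundary T Y ∧ c ∈ cylBoundary T Y ∧
    a ≠ b ∧ a ≠ c ∧ b ≠ c

/-- `|∂Y| = 2`. -/
def TwoBoundary (Y : Set (Sym2 V)) : Prop :=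
  ∃ a b : V, a ≠ b ∧ cylBoundary T Y = {a, b}

/-- The defining clauses of the map `Φ` from cross-connected components to the subdivided
tree of cylinders. -/
def PhiSpec (G : Type*) [Group G] [MulAction G V] (v₀ : V)
    (Φ : Set (Set G) → TcSubV V) : Prop :=
  (∀ (C : Set (Set G)) (Y : Set (Sym2 V)), IsCCC T G v₀ C → IsCylinder T G Y →
      CCCBasedOn G Y C → ¬ PeripheralCCC T G v₀ C → Φ C = tcY Y) ∧
  (∀ (Y : Set (Sym2 V)) (v : V), IsCylinder T G Y → v ∈ cylBoundary T Y →
      FiniteValenceIn Y v → BigBoundary T Y →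
      Φ (ccOf T G v₀ (XvY T G v₀ Y v)) = tcMid v Y) ∧
  (∀ (Y : Set (Sym2 V)) (v : V), IsCylinder T G Y → v ∈ cylBoundary T Y →
      FiniteValenceIn Y v → TwoBoundary T Y →
      Φ (ccOf T G v₀ (XvY T G v₀ Y v)) = tcY Y)

/-- `x` is the projection of `w` to the subtree `A`: the point of `A` between `w` and every
point of `A`. -/
def projIs (A : Set V) (w x : V) : Prop := x ∈ A ∧ ∀ a ∈ A, Btw T w x a

end SSRN

namespace SSRN

section GroupLemmas
variable {G : Type*} [Group G]

theorem hFin_iff {H : Subgroup G} {X : Set G} :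
    HFin H X ↔ ∃ F : Finset G, ∀ x ∈ X, ∃ f ∈ F, x * f⁻¹ ∈ H := by
  unfold HFin
  refine exists_congr fun F => ?_
  constructor
  · intro h x hx
    have := h hx
    simp only [Set.mem_iUnion, Set.mem_image, SetLike.mem_coe] at this
    obtain ⟨f, hf, k, hk, rfl⟩ := this
    exact ⟨f, hf, by simpa using hk⟩
  · intro h x hx
    obtain ⟨f, hf, hk⟩ := h x hx
    simp only [Set.mem_iUnion, Set.mem_image, SetLike.mem_coe]
    exact ⟨f, hf, _, hk, by simp⟩

theorem HFin.mono {H : Subgroup G} {X X' : Set G} (h : HFin H X') (hs : X ⊆ X') : HFin H X := by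
  obtain ⟨F, hF⟩ := h
  exact ⟨F, hs.trans hF⟩

theorem HFin.union {H : Subgroup G} {X X' : Set G} (h : HFin H X) (h' : HFin H X') :
    HFin H (X ∪ X') := by
  classical
  rw [hFin_iff] at *
  obtain ⟨F, hF⟩ := h
  obtain ⟨F', hF'⟩ := h'
  refine ⟨F ∪ F', ?_⟩
  rintro x (hx | hx)
  · obtain ⟨f, hf, h⟩ := hF x hx
    exact ⟨f, by simp [hf], h⟩
  · obtain ⟨f, hf, h⟩ := hF' x hx
    exact ⟨f, by simp [hf], h⟩

theorem hFin_empty {H : Subgroup G} : HFin H (∅ : Set G) := ⟨∅, by simp⟩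

theorem hFin_biUnion {ι : Type*} {H : Subgroup G} {s : Set ι} (hs : s.Finite) (X : ι → Set G)
    (h : ∀ i ∈ s, HFin H (X i)) : HFin H (⋃ i ∈ s, X i) := by
  induction s, hs using Set.Finite.induction_on with
  | empty => simpa using hFin_empty
  | @insert a s _ _ ih =>
    rw [Set.biUnion_insert]
    exact (h a (by simp)).union (ih fun i hi => h i (by simp [hi]))

theorem HFin.mul_right {H : Subgroup G} {X : Set G} (h : HFin H X) (s : G) :
    HFin H {g | g * s ∈ X} := by
  classical
  rw [hFin_iff] at *
  obtain ⟨F, hF⟩ := h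
  refine ⟨F.image (· * s⁻¹), fun x hx => ?_⟩
  obtain ⟨f, hf, h⟩ := hF _ hx
  refine ⟨f * s⁻¹, Finset.mem_image_of_mem _ hf, ?_⟩
  simpa [mul_assoc] using h

/-- If `K` is covered by finitely many cosets of `H` then the relative index is finite. -/
theorem relIndex_of_hFin {H K : Subgroup G} (h : HFin H (K : Set G)) : H.relIndex K ≠ 0 := by
  rw [hFin_iff] at h
  obtain ⟨F, hF⟩ := h
  choose! f hf hfH using hF
  have : Finite (K ⧸ H.subgroupOf K) := by
    refine Finite.of_injective (β := F)
      (fun q => ⟨f ((q.out : K) : G)⁻¹, hf _ (K.inv_mem (q.out).2)⟩) ?_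
    intro q q' hqq
    simp only [Subtype.mk.injEq] at hqq
    rw [← Quotient.out_eq' q, ← Quotient.out_eq' q']
    refine QuotientGroup.eq.2 ?_
    rw [Subgroup.mem_subgroupOf]
    have h1 := hfH _ (K.inv_mem (q.out).2)
    have h2 := hfH _ (K.inv_mem (q'.out).2)
    rw [← hqq] at h2
    have := H.mul_mem h1 (H.inv_mem h2)
    simpa using this
  rw [Subgroup.relIndex]
  exact Subgroup.index_ne_zero_of_finite

theorem hFin_of_relIndex {H K : Subgroup G} (h : H.relIndex K ≠ 0) : HFin H (K : Set G) := by
  classical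
  have : (H.subgroupOf K).FiniteIndex := ⟨h⟩
  have : Finite (K ⧸ H.subgroupOf K) := Subgroup.finite_quotient_of_finiteIndex
  have := Fintype.ofFinite (K ⧸ H.subgroupOf K)
  rw [hFin_iff]
  refine ⟨Finset.univ.image fun q : K ⧸ H.subgroupOf K => ((q.out : K) : G)⁻¹, fun x hx => ?_⟩
  refine ⟨_, Finset.mem_image_of_mem _
    (Finset.mem_univ (QuotientGroup.mk (⟨x⁻¹, K.inv_mem hx⟩ : K))), ?_⟩
  have h1 : (QuotientGroup.mk (s := H.subgroupOf K) (⟨x⁻¹, K.inv_mem hx⟩ : K)) =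
    QuotientGroup.mk ((QuotientGroup.mk (s := H.subgroupOf K) (⟨x⁻¹, K.inv_mem hx⟩ : K)).out) :=
    (Quotient.out_eq' _).symm
  rw [QuotientGroup.eq, Subgroup.mem_subgroupOf] at h1
  simpa using h1

theorem HFin.trans_relIndex {H K : Subgroup G} {X : Set G} (hX : HFin K X)
    (h : H.relIndex K ≠ 0) : HFin H X := by
  rw [hFin_iff] at hX
  obtain ⟨F, hF⟩ := hX
  have h1 := hFin_of_relIndex h
  refine (hFin_biUnion F.finite_toSet (fun f => {g | g * f⁻¹ ∈ (K : Set G)})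
    fun f _ => h1.mul_right f⁻¹).mono fun x hx => ?_
  obtain ⟨f, hf, hk⟩ := hF x hx
  simp only [Set.mem_iUnion]
  exact ⟨f, hf, hk⟩

theorem HFin.comm {H K : Subgroup G} {X : Set G} (hX : HFin K X)
    (h : Subgroup.Commensurable H K) : HFin H X := hX.trans_relIndex h.1

theorem isAI_iff {H : Subgroup G} {X : Set G} :
    IsAI H X ↔ (∀ h ∈ H, ∀ x, h * x ∈ X ↔ x ∈ X) ∧
      ∀ s : G, HFin H {g | ¬ (g * s ∈ X ↔ g ∈ X)} := by
  unfold IsAI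
  refine and_congr ?_ ?_
  · constructor
    · intro h k hk x
      constructor
      · intro hx
        rw [← h k⁻¹ (H.inv_mem hk)]
        exact ⟨_, hx, by simp⟩
      · intro hx
        rw [← h k hk]
        exact ⟨_, hx, rfl⟩
    · intro h k hk
      ext x
      constructor
      · rintro ⟨y, hy, rfl⟩
        exact (h k hk y).2 hy
      · intro hx
        exact ⟨k⁻¹ * x, (h _ (H.inv_mem hk) x).2 hx, by simp⟩
  · have key : ∀ s : G, ((· * s) '' X) ∆ X = {g | ¬ (g * s⁻¹ ∈ X ↔ g ∈ X)} := by
      intro s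
      ext g
      have : g ∈ (· * s) '' X ↔ g * s⁻¹ ∈ X := by
        constructor
        · rintro ⟨y, hy, rfl⟩
          simpa using hy
        · intro h
          exact ⟨_, h, by simp⟩
      simp only [Set.mem_symmDiff, this, Set.mem_ofPred_eq]
      tauto
    constructor
    · intro h s
      have := h s⁻¹
      rwa [key, inv_inv] at this
    · intro h s
      rw [key]
      exact h _

theorem IsAI.compl {H : Subgroup G} {X : Set G} (h : IsAI H X) : IsAI H Xᶜ := by
  rw [isAI_iff] at *
  refine ⟨fun k hk x => not_congr (h.1 k hk x), fun s => (h.2 s).mono ?_⟩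
  intro g hg
  simp only [Set.mem_ofPred_eq, Set.mem_compl_iff] at *
  tauto

theorem NontrivAI.compl {H : Subgroup G} {X : Set G} (h : NontrivAI H X) : NontrivAI H Xᶜ :=
  ⟨h.1.compl, h.2.2, by simpa using h.2.1⟩

theorem commens_of_equiv {H K : Subgroup G} {X X' : Set G} (hX : NontrivAI H X)
    (hX' : NontrivAI K X') (h : HFin H (X ∆ X')) : Subgroup.Commensurable H K := by
  obtain ⟨hX1, hX2, hX3⟩ := hX
  obtain ⟨hX1', hX2', hX3'⟩ := hX'
  rw [isAI_iff] at hX1 hX1'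
  constructor
  · apply relIndex_of_hFin
    obtain ⟨x, hx⟩ : X'.Nonempty := by
      rw [Set.nonempty_iff_ne_empty]
      rintro rfl
      exact hX2' hFin_empty
    obtain ⟨y, hy⟩ : (X'ᶜ).Nonempty := by
      rw [Set.nonempty_iff_ne_empty]
      intro h0
      rw [h0] at hX3'
      exact hX3' hFin_empty
    have hD : HFin H {g | ¬ (g * (x⁻¹ * y) ∈ X' ↔ g ∈ X')} := by
      refine (((hX1.2 (x⁻¹ * y)).union h).union (h.mul_right (x⁻¹ * y))).mono ?_
      intro g hg
      simp only [Set.mem_ofPred_eq, Set.mem_union, Set.mem_symmDiff] at *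
      tauto
    refine (hD.mul_right x).mono ?_
    intro k hk
    simp only [Set.mem_ofPred_eq]
    have h1 := hX1'.1 k hk x
    have h2 := hX1'.1 k hk y
    have h3 : k * x * (x⁻¹ * y) = k * y := by group
    rw [h3]
    have : y ∉ X' := hy
    tauto
  · apply relIndex_of_hFin
    have h' := h
    rw [hFin_iff] at h
    obtain ⟨F, hF⟩ := h
    set Z : Set G := {g | ∃ f ∈ F, g * f⁻¹ ∈ H} with hZ
    have hZfin : HFin H Z := hFin_iff.2 ⟨F, fun x hx => hx⟩
    have hZinv : ∀ k ∈ H, ∀ g, k * g ∈ Z → g ∈ Z := by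
      rintro k hk g ⟨f, hf, hkf⟩
      refine ⟨f, hf, ?_⟩
      have := H.mul_mem (H.inv_mem hk) hkf
      simpa [mul_assoc] using this
    obtain ⟨x, hx, hxZ⟩ : ∃ x, x ∈ X ∧ x ∉ Z := by
      by_contra! hc
      exact hX2 (hZfin.mono hc)
    obtain ⟨y, hy, hyZ⟩ : ∃ y, y ∈ Xᶜ ∧ y ∉ Z := by
      by_contra! hc
      exact hX3 (hZfin.mono hc)
    refine ((hX1'.2 (x⁻¹ * y)).mul_right x).mono ?_
    intro k hk
    have h1 := hX1.1 k hk x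
    have h2 := hX1.1 k hk y
    have h3 : k * x * (x⁻¹ * y) = k * y := by group
    have h4 : k * x ∉ X ∆ X' := fun hc => hxZ (hZinv k hk x (hF _ hc))
    have h5 : k * y ∉ X ∆ X' := fun hc => hyZ (hZinv k hk y (hF _ hc))
    have h6 : y ∉ X := hy
    simp only [Set.mem_ofPred_eq, h3]
    simp only [Set.mem_symmDiff] at h4 h5
    tauto

theorem not_nontriv_of_hFin {H K : Subgroup G} {X : Set G} (hK : ¬ HFin K (Set.univ : Set G))
    (hX : HFin K X) (h : NontrivAI H X) : False := by
  obtain ⟨hX1, hX2, -⟩ := h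
  rw [isAI_iff] at hX1
  rw [hFin_iff] at hX
  obtain ⟨F, hF⟩ := hX
  have hs : ∀ f : G, ∃ s : G, ¬ ∃ f' ∈ F, f * s * f'⁻¹ ∈ K := by
    intro f
    by_contra! hc
    apply hK
    rw [hFin_iff]
    refine ⟨F, fun x _ => ?_⟩
    obtain ⟨f', hf', h⟩ := hc (f⁻¹ * x)
    exact ⟨f', hf', by simpa using h⟩
  choose s hs using hs
  apply hX2
  refine (hFin_biUnion F.finite_toSet (fun f => {g | ¬ (g * s f ∈ X ↔ g ∈ X)})
    fun f _ => hX1.2 (s f)).mono fun x hx => ?_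
  obtain ⟨f, hf, hk⟩ := hF x hx
  simp only [Set.mem_iUnion]
  refine ⟨f, hf, ?_⟩
  intro hc
  obtain ⟨f', hf', hk'⟩ := hF _ (hc.2 hx)
  apply hs f
  refine ⟨f', hf', ?_⟩
  have := K.mul_mem (K.inv_mem hk) hk'
  simpa [mul_assoc] using this

theorem commens_inf {H K L : Subgroup G} (h : Subgroup.Commensurable H L)
    (h' : Subgroup.Commensurable K L) : Subgroup.Commensurable (H ⊓ K) L :=
  ⟨Subgroup.relIndex_inf_ne_zero h.1 h'.1,
    fun hc => h.2 (Subgroup.relIndex_eq_zero_of_le_right inf_le_left hc)⟩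

end GroupLemmas

end SSRN
namespace SSRN

section TreeLemmas
variable {V : Type*} {T : SimpleGraph V}

/-- `w` lies on every walk from `a` to `b`. -/
def BB (T : SimpleGraph V) (a w b : V) : Prop := ∀ p : T.Walk a b, w ∈ p.support

theorem btw_iff_bb {a w b : V} : Btw T a w b ↔ BB T a w b := by
  classical
  constructor
  · intro h p
    exact p.support_bypass_subset_support (h p.bypass p.bypass_isPath)
  · intro h p _
    exact h p

theorem BB.symm {a w b : V} (h : BB T a w b) : BB T b w a := by
  intro p
  have := h p.reverse
  simpa using this

theorem bb_left (a b : V) : BB T a a b := fun p => p.start_mem_support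

theorem bb_right (a b : V) : BB T a b b := fun p => p.end_mem_support

theorem BB.eq_of_same {a w : V} (h : BB T a w a) : w = a := by
  simpa using h SimpleGraph.Walk.nil

theorem BB.sep {a w b : V} (h : BB T a w b) (x : V) : BB T x w a ∨ BB T x w b := by
  by_contra! hc
  simp only [BB, not_forall] at hc
  obtain ⟨⟨p, hp⟩, q, hq⟩ := hc
  have := h (p.reverse.append q)
  rw [SimpleGraph.Walk.mem_support_append_iff] at this
  simp only [SimpleGraph.Walk.support_reverse, List.mem_reverse] at this
  tauto

theorem BB.trans {a w u b : V} (h : BB T a w u) (h' : BB T a u b) : BB T a w b := by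
  classical
  intro p
  exact p.support_takeUntil_subset_support (h' p) (h (p.takeUntil u (h' p)))

theorem bb_of_path (hT : T.IsTree) {a w b : V} {p : T.Walk a b} (hp : p.IsPath)
    (hw : w ∈ p.support) : BB T a w b := by
  classical
  intro q
  have := (hT.isAcyclic.subsingleton_path _ _).elim ⟨p, hp⟩ ⟨q.bypass, q.bypass_isPath⟩
  have h2 : p = q.bypass := congrArg Subtype.val this
  rw [h2] at hw
  exact q.support_bypass_subset_support hw

theorem bb_nbrs (hT : T.IsTree) {w a b : V} (ha : T.Adj w a) (hb : T.Adj w b) (hab : a ≠ b) :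
    BB T a w b := by
  refine bb_of_path hT (p := .cons ha.symm (.cons hb .nil)) ?_ (by simp)
  simp [SimpleGraph.Walk.cons_isPath_iff, ha.ne', hb.ne, hab]

theorem BB.dist_lt (hT : T.IsTree) {p w x : V} (h : BB T p w x) (hne : w ≠ x) :
    T.dist p w < T.dist p x := by
  classical
  obtain ⟨q, hq⟩ := hT.connected.exists_walk_length_eq_dist p x
  rw [← hq]
  exact lt_of_le_of_lt (SimpleGraph.dist_le (q.takeUntil w (h q)))
    (SimpleGraph.Walk.length_takeUntil_lt_length (h q) hne)

theorem BB.dist_le (hT : T.IsTree) {p w x : V} (h : BB T p w x) :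
    T.dist p w ≤ T.dist p x := by
  by_cases hne : w = x
  · rw [hne]
  · exact (h.dist_lt hT hne).le

theorem mem_cobdry {S : Set V} {a b : V} : s(a, b) ∈ cobdry T S ↔
    T.Adj a b ∧ ¬ (a ∈ S ↔ b ∈ S) := by
  simp only [cobdry, Set.mem_ofPred_eq, SimpleGraph.mem_edgeSet]
  refine and_congr_right fun _ => ?_
  constructor
  · rintro ⟨u, v, h, hu, hv⟩
    rw [Sym2.eq_iff] at h
    rcases h with ⟨rfl, rfl⟩ | ⟨rfl, rfl⟩ <;> tauto
  · intro h
    by_cases ha : a ∈ S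
    · exact ⟨a, b, rfl, ha, by tauto⟩
    · exact ⟨b, a, Sym2.eq_swap, by tauto, ha⟩

theorem cobdry_subset {S : Set V} {D : Set (Sym2 V)} :
    cobdry T S ⊆ D ↔ ∀ a b, T.Adj a b → s(a, b) ∉ D → (a ∈ S ↔ b ∈ S) := by
  constructor
  · intro h a b hab hD
    by_contra hc
    exact hD (h (mem_cobdry.2 ⟨hab, hc⟩))
  · intro h e
    induction e using Sym2.ind with
    | _ a b =>
      intro he
      rw [mem_cobdry] at he
      by_contra hc
      exact he.2 (h a b he.1 hc)

theorem cobdry_compl {S : Set V} : cobdry T Sᶜ = cobdry T S := by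
  ext e
  induction e using Sym2.ind with
  | _ a b =>
    simp only [mem_cobdry, Set.mem_compl_iff]
    tauto

theorem cobdry_inter {S S' : Set V} : cobdry T (S ∩ S') ⊆ cobdry T S ∪ cobdry T S' := by
  intro e
  induction e using Sym2.ind with
  | _ a b =>
    simp only [Set.mem_union, mem_cobdry, Set.mem_inter_iff]
    tauto

theorem mem_iff_of_walk {S : Set V} {a b : V} (p : T.Walk a b)
    (h : ∀ e ∈ p.edges, e ∉ cobdry T S) : a ∈ S ↔ b ∈ S := by
  induction p with
  | nil => rfl
  | @cons x y z hxy q ih =>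
    simp only [SimpleGraph.Walk.edges_cons, List.mem_cons, forall_eq_or_imp] at h
    rw [← ih h.2]
    have := h.1
    rw [mem_cobdry] at this
    tauto

theorem exists_edge_of_walk {S : Set V} {a b : V} (p : T.Walk a b)
    (h : ¬ (a ∈ S ↔ b ∈ S)) : ∃ e ∈ p.edges, e ∈ cobdry T S := by
  by_contra! hc
  exact h (mem_iff_of_walk p hc)

theorem trivial_of_cobdry_empty (hT : T.IsTree) {S : Set V} (h : cobdry T S = ∅) {a : V} (b : V)
    (ha : a ∈ S) : b ∈ S := by
  obtain ⟨p⟩ := hT.connected.preconnected a b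
  rw [← mem_iff_of_walk (S := S) p (by simp [h])]
  exact ha

theorem IsSpecialForest.compl {S : Set V} {Y : Set (Sym2 V)} (h : IsSpecialForest T S Y) :
    IsSpecialForest T Sᶜ Y := by
  unfold IsSpecialForest at *
  rwa [cobdry_compl]

theorem IsSpecialForest.inter {S S' : Set V} {Y : Set (Sym2 V)} (h : IsSpecialForest T S Y)
    (h' : IsSpecialForest T S' Y) : IsSpecialForest T (S ∩ S') Y :=
  ⟨(h.1.union h'.1).subset cobdry_inter, cobdry_inter.trans (Set.union_subset h.2 h'.2)⟩

theorem end_mem_halfTree {x y : V} : y ∈ halfTree T x y :=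
  ⟨.nil, by simp, by simp⟩

theorem start_notMem_halfTree (hT : T.IsTree) {x y : V} (h : T.Adj x y) : x ∉ halfTree T x y := by
  rintro ⟨p, hp, hpe⟩
  have := (hT.isAcyclic.subsingleton_path _ _).elim ⟨p, hp⟩ (SimpleGraph.Path.singleton h.symm)
  have h2 : p = _ := congrArg Subtype.val this
  rw [h2] at hpe
  simp [SimpleGraph.Path.singleton] at hpe

theorem cobdry_halfTree {x y : V} : cobdry T (halfTree T x y) ⊆ {s(x, y)} := by
  classical
  rw [cobdry_subset]
  have key : ∀ a b, T.Adj a b → s(a, b) ≠ s(x, y) → a ∈ halfTree T x y → b ∈ halfTree T x y := by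
    rintro a b hab hne ⟨p, hp, hpe⟩
    refine ⟨(p.concat hab).bypass, SimpleGraph.Walk.bypass_isPath _, fun hc => ?_⟩
    have := SimpleGraph.Walk.edges_bypass_subset_edges _ hc
    rw [SimpleGraph.Walk.edges_concat] at this
    simp only [List.concat_eq_append, List.mem_append, List.mem_singleton] at this
    rcases this with h | h
    · exact hpe h
    · exact hne h.symm
  intro a b hab hne
  refine ⟨key a b hab hne, key b a hab.symm ?_⟩
  rw [Sym2.eq_swap]
  exact hne

theorem halfTree_special {x y : V} {Y : Set (Sym2 V)} (h : s(x, y) ∈ Y) :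
    IsSpecialForest T (halfTree T x y) Y :=
  ⟨(Set.finite_singleton _).subset cobdry_halfTree,
    cobdry_halfTree.trans (by simpa using h)⟩

/-- A Boolean algebra of vertex sets containing the half trees of edges in `D` contains all
sets with coboundary in `D`. -/
theorem boolean_gen (hT : T.IsTree) (P : Set V → Prop) (hc : ∀ A, P A → P Aᶜ)
    (hi : ∀ A B, P A → P B → P (A ∩ B)) (h0 : P ∅) (D : Set (Sym2 V)) (hD : D.Finite)
    (hh : ∀ x y, T.Adj x y → s(x, y) ∈ D → P (halfTree T x y)) :
    ∀ S : Set V, cobdry T S ⊆ D → P S := by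
  classical
  have hu : ∀ A B, P A → P B → P (A ∪ B) := by
    intro A B hA hB
    have := hc _ (hi _ _ (hc _ hA) (hc _ hB))
    rwa [Set.compl_inter, compl_compl, compl_compl] at this
  have h1 : P Set.univ := by simpa using hc _ h0
  induction D, hD using Set.Finite.induction_on with
  | empty =>
    intro S hS
    have hS : cobdry T S = ∅ := Set.subset_empty_iff.1 hS
    rcases S.eq_empty_or_nonempty with rfl | ⟨a, ha⟩
    · exact h0
    · have : S = Set.univ := Set.eq_univ_of_forall fun b => trivial_of_cobdry_empty hT hS b ha
      rwa [this]
  | @insert e D _ _ ih =>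
    intro S hS
    have ih := ih fun x y hxy hxyD => hh x y hxy (by simp [hxyD])
    induction e using Sym2.ind with
    | _ x y =>
    by_cases hxy : T.Adj x y
    swap
    · apply ih
      rw [cobdry_subset] at *
      intro a b hab habD
      apply hS a b hab
      simp only [Set.mem_insert_iff, not_or]
      refine ⟨?_, habD⟩
      intro h
      rw [Sym2.eq_iff] at h
      rcases h with ⟨rfl, rfl⟩ | ⟨rfl, rfl⟩
      · exact hxy hab
      · exact hxy hab.symm
    set K := halfTree T x y with hK
    have hKy : y ∈ K := end_mem_halfTree
    have hKx : x ∉ K := start_notMem_halfTree hT hxy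
    have hPK : P K := hh x y hxy (by simp)
    have hKc := cobdry_subset.1 (cobdry_halfTree (T := T) (x := x) (y := y))
    rw [← hK] at hKc
    have hS' := cobdry_subset.1 hS
    have e1 : P {w | (w ∈ K ∧ w ∈ S) ∨ (w ∉ K ∧ y ∈ S)} := by
      apply ih
      rw [cobdry_subset]
      intro a b hab habD
      simp only [Set.mem_ofPred_eq]
      by_cases hne : s(a, b) = s(x, y)
      · rw [Sym2.eq_iff] at hne
        rcases hne with ⟨rfl, rfl⟩ | ⟨rfl, rfl⟩ <;> tauto
      · have := hKc a b hab hne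
        have := hS' a b hab (by simp [hne, habD])
        tauto
    have e2 : P {w | (w ∉ K ∧ w ∈ S) ∨ (w ∈ K ∧ x ∈ S)} := by
      apply ih
      rw [cobdry_subset]
      intro a b hab habD
      simp only [Set.mem_ofPred_eq]
      by_cases hne : s(a, b) = s(x, y)
      · rw [Sym2.eq_iff] at hne
        rcases hne with ⟨rfl, rfl⟩ | ⟨rfl, rfl⟩ <;> tauto
      · have := hKc a b hab hne
        have := hS' a b hab (by simp [hne, habD])
        tauto
    convert hu _ _ (hi _ _ e1 hPK) (hi _ _ e2 (hc _ hPK)) using 1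
    ext w
    simp only [Set.mem_union, Set.mem_inter_iff, Set.mem_ofPred_eq, Set.mem_compl_iff]
    tauto

/-- Every vertex of valence at least 3 has a neighbour farther away from `p`. -/
theorem exists_farther (hT : T.IsTree)
    (hval3 : ∀ w : V, ∃ a b c : V, a ≠ b ∧ a ≠ c ∧ b ≠ c ∧ T.Adj w a ∧ T.Adj w b ∧ T.Adj w c)
    (p w : V) : ∃ w', T.Adj w w' ∧ BB T p w w' := by
  obtain ⟨a, b, c, hab, -, -, ha, hb, -⟩ := hval3 w
  rcases (bb_nbrs hT ha hb hab).sep p with h | h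
  · exact ⟨a, ha, h⟩
  · exact ⟨b, hb, h⟩

theorem exists_far (hT : T.IsTree)
    (hval3 : ∀ w : V, ∃ a b c : V, a ≠ b ∧ a ≠ c ∧ b ≠ c ∧ T.Adj w a ∧ T.Adj w b ∧ T.Adj w c)
    (p w : V) (n : ℕ) : ∃ w', BB T p w w' ∧ n ≤ T.dist p w' := by
  induction n with
  | zero => exact ⟨w, bb_right _ _, by simp⟩
  | succ n ih =>
    obtain ⟨w', h1, h2⟩ := ih
    obtain ⟨w'', h3, h4⟩ := exists_farther hT hval3 p w'
    refine ⟨w'', h1.trans h4, ?_⟩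
    have := h4.dist_lt hT h3.ne
    omega

/-- An infinite set of finite coboundary contains a branch away from `p`. -/
theorem exists_branch (hT : T.IsTree) {S : Set V} (hS : ¬ S.Finite) (hc : (cobdry T S).Finite)
    (p : V) : ∃ w, ∀ x, BB T p w x → x ∈ S := by
  classical
  choose path hpath using fun x : V => (hT.existsUnique_path p x).exists
  set K : Set V := ⋃ e ∈ cobdry T S, ⋃ x ∈ {x | x ∈ e}, {y | y ∈ (path x).support} with hK
  have hKfin : K.Finite := by
    refine hc.biUnion fun e _ => Set.Finite.biUnion ?_ fun x _ => List.finite_toSet _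
    induction e using Sym2.ind with
    | _ a b =>
      refine (Set.toFinite {a, b}).subset ?_
      intro x hx
      simpa using hx
  obtain ⟨w, hwS, hwK⟩ : ∃ w ∈ S, w ∉ K := by
    by_contra! h
    exact hS (hKfin.subset h)
  refine ⟨w, fun x hx => ?_⟩
  obtain ⟨q, hq⟩ := (hT.existsUnique_path w x).exists
  rw [← mem_iff_of_walk (S := S) q]
  · exact hwS
  · intro e he hec
    apply hwK
    induction e using Sym2.ind with
    | _ a b =>
      simp only [hK, Set.mem_iUnion]
      refine ⟨_, hec, a, by simp, ?_⟩
      have ha : a ∈ q.support := q.fst_mem_support_of_mem_edges he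
      have h1 : BB T w a x := bb_of_path hT hq ha
      -- either `w` is between `p` and `a`, or between `a` and `x`, forcing `a = w`
      have h2 : BB T p w a := by
        rcases hx.sep a with h | h
        · exact h.symm
        · by_cases haw : a = w
          · subst haw
            exact bb_right _ _
          · have h3 := (h.symm).dist_lt hT (Ne.symm haw)
            have h4 := (h1.symm).dist_lt hT haw
            omega
      exact h2 (path a)

end TreeLemmas

end SSRN
namespace SSRN

section ActionLemmas
variable {G V : Type*} [Group G] [MulAction G V] {T : SimpleGraph V}

/-- The graph homomorphism given by `g`. -/
def actHom (hact : ActsOn T G) (g : G) : T →g T := ⟨(g • ·), fun {a b} h => hact g a b h⟩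

theorem adj_smul (hact : ActsOn T G) (g : G) {a b : V} : T.Adj (g • a) (g • b) ↔ T.Adj a b := by
  constructor
  · intro h
    simpa using hact g⁻¹ _ _ h
  · exact hact g a b

theorem BB.smul (hact : ActsOn T G) (g : G) {a w b : V} (h : BB T a w b) :
    BB T (g • a) (g • w) (g • b) := by
  intro q
  have ea : actHom hact g⁻¹ (g • a) = a := inv_smul_smul g a
  have eb : actHom hact g⁻¹ (g • b) = b := inv_smul_smul g b
  have h1 := h ((q.map (actHom hact g⁻¹)).copy ea eb)
  rw [SimpleGraph.Walk.support_copy, SimpleGraph.Walk.support_map, List.mem_map] at h1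
  obtain ⟨x, hx, hxw⟩ := h1
  have : g⁻¹ • x = w := hxw
  rw [← this, smul_inv_smul]
  exact hx

theorem dist_smul_le (hT : T.IsTree) (hact : ActsOn T G) (g : G) (a b : V) :
    T.dist (g • a) (g • b) ≤ T.dist a b := by
  obtain ⟨q, hq⟩ := hT.connected.exists_walk_length_eq_dist a b
  rw [← hq, ← SimpleGraph.Walk.length_map (actHom hact g)]
  exact SimpleGraph.dist_le _

theorem mem_edgeStab {g : G} {e : Sym2 V} : g ∈ edgeStab G e ↔ Sym2.map (g • ·) e = e := Iff.rfl

theorem smul_eq_of_mem_edgeStab (hinv : NoInversions T G) {g : G} {a b : V} (hab : T.Adj a b)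
    (hg : g ∈ edgeStab G s(a, b)) : g • a = a ∧ g • b = b := by
  rw [mem_edgeStab, Sym2.map_mk, Sym2.eq_iff] at hg
  rcases hg with h | h
  · exact h
  · exact absurd h (hinv g a b hab)

theorem smul_eq_of_mem_edge (hinv : NoInversions T G) {g : G} {e : Sym2 V} (he : e ∈ T.edgeSet)
    {a : V} (ha : a ∈ e) (hg : g ∈ edgeStab G e) : g • a = a := by
  induction e using Sym2.ind with
  | _ x y =>
    have := smul_eq_of_mem_edgeStab hinv he hg
    rw [Sym2.mem_iff] at ha
    rcases ha with rfl | rfl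
    · exact this.1
    · exact this.2

theorem map_smul_smul (g h : G) (e : Sym2 V) :
    Sym2.map (g • ·) (Sym2.map (h • ·) e) = Sym2.map ((g * h) • ·) e := by
  induction e using Sym2.ind with
  | _ x y => simp [mul_smul]

theorem map_one_smul (e : Sym2 V) : Sym2.map ((1 : G) • ·) e = e := by
  induction e using Sym2.ind with
  | _ x y => simp

theorem edgeStab_smul (g : G) (e : Sym2 V) :
    edgeStab G (Sym2.map (g • ·) e) = ConjAct.toConjAct g • edgeStab G e := by
  ext x
  rw [Subgroup.mem_pointwise_smul_iff_inv_smul_mem, ← map_inv, ConjAct.toConjAct_smul, inv_inv,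
    mem_edgeStab, mem_edgeStab, ← map_smul_smul (g⁻¹ * x) g, ← map_smul_smul g⁻¹ x]
  constructor
  · intro h
    rw [h, map_smul_smul, inv_mul_cancel, map_one_smul]
  · intro h
    have := congrArg (Sym2.map (g • ·)) h
    rw [map_smul_smul g g⁻¹, mul_inv_cancel, map_one_smul] at this
    exact this

theorem map_mem_edgeSet (hact : ActsOn T G) (g : G) {e : Sym2 V} (he : e ∈ T.edgeSet) :
    Sym2.map (g • ·) e ∈ T.edgeSet := by
  induction e using Sym2.ind with
  | _ x y => exact hact g x y he

theorem IsCylinder.eq_of_mem {Y Y' : Set (Sym2 V)} (hY : IsCylinder T G Y)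
    (hY' : IsCylinder T G Y') {e : Sym2 V} (he : e ∈ Y) (he' : e ∈ Y') : Y = Y' := by
  ext f
  constructor
  · intro hf
    exact (hY'.2.2 e he' f (hY.2.1 hf)).2 ((hY.2.2 e he f (hY.2.1 hf)).1 hf)
  · intro hf
    exact (hY.2.2 e he f (hY'.2.1 hf)).2 ((hY'.2.2 e he' f (hY'.2.1 hf)).1 hf)

theorem IsCylinder.comm {Y : Set (Sym2 V)} (hY : IsCylinder T G Y) {e e' : Sym2 V}
    (he : e ∈ Y) (he' : e' ∈ Y) : Subgroup.Commensurable (edgeStab G e) (edgeStab G e') :=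
  (hY.2.2 e he e' (hY.2.1 he')).1 he'

theorem IsCylinder.eq_of_comm {Y Y' : Set (Sym2 V)} (hY : IsCylinder T G Y)
    (hY' : IsCylinder T G Y') {e e' : Sym2 V} (he : e ∈ Y) (he' : e' ∈ Y')
    (h : Subgroup.Commensurable (edgeStab G e) (edgeStab G e')) : Y = Y' :=
  hY.eq_of_mem hY' ((hY.2.2 e he e' (hY'.2.1 he')).2 h) he'

theorem exists_cylinder {e : Sym2 V} (he : e ∈ T.edgeSet) :
    ∃ Z : Set (Sym2 V), IsCylinder T G Z ∧ e ∈ Z := by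
  refine ⟨{f | f ∈ T.edgeSet ∧ Subgroup.Commensurable (edgeStab G e) (edgeStab G f)},
    ⟨⟨e, he, .refl _⟩, fun f hf => hf.1, ?_⟩, he, .refl _⟩
  rintro f ⟨hf, hef⟩ f' hf'
  constructor
  · rintro ⟨_, h⟩
    exact hef.symm.trans h
  · intro h
    exact ⟨hf', hef.trans h⟩

theorem IsCylinder.smul (hact : ActsOn T G) {Y : Set (Sym2 V)} (hY : IsCylinder T G Y) (g : G) :
    IsCylinder T G (Sym2.map (g • ·) '' Y) := by
  obtain ⟨⟨e, he⟩, hsub, h⟩ := hY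
  refine ⟨⟨_, e, he, rfl⟩, ?_, ?_⟩
  · rintro _ ⟨f, hf, rfl⟩
    exact map_mem_edgeSet hact g (hsub hf)
  · rintro _ ⟨f, hf, rfl⟩ f' hf'
    have h1 := map_mem_edgeSet hact g⁻¹ hf'
    have h2 : Sym2.map (g • ·) (Sym2.map (g⁻¹ • ·) f') = f' := by
      rw [map_smul_smul, mul_inv_cancel, map_one_smul]
    have h3 := h f hf _ h1
    rw [Subgroup.Commensurable.commensurable_conj (ConjAct.toConjAct g), ← edgeStab_smul,
      ← edgeStab_smul, h2] at h3
    rw [← h3]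
    constructor
    · rintro ⟨k, hk, rfl⟩
      rw [map_smul_smul, inv_mul_cancel, map_one_smul]
      exact hk
    · intro hk
      exact ⟨_, hk, h2⟩

theorem mem_cylVerts_smul {Y : Set (Sym2 V)} {g : G} {v : V} (h : v ∈ cylVerts Y) :
    g • v ∈ cylVerts (Sym2.map (g • ·) '' Y) := by
  obtain ⟨e, he, hv⟩ := h
  exact ⟨_, ⟨e, he, rfl⟩, Sym2.mem_map.2 ⟨v, hv, rfl⟩⟩

theorem image_inv_image (g : G) (Y : Set (Sym2 V)) :
    Sym2.map (g • ·) '' (Sym2.map (g⁻¹ • ·) '' Y) = Y := by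
  ext e
  simp only [Set.image_image, map_smul_smul, mul_inv_cancel, map_one_smul, Set.image_id']

theorem mem_cylBoundary_smul (hact : ActsOn T G) {Y : Set (Sym2 V)} {g : G} {v : V}
    (h : v ∈ cylBoundary T Y) : g • v ∈ cylBoundary T (Sym2.map (g • ·) '' Y) := by
  obtain ⟨h1, e, he, hv, heY⟩ := h
  refine ⟨mem_cylVerts_smul h1, _, map_mem_edgeSet hact g he, Sym2.mem_map.2 ⟨v, hv, rfl⟩, ?_⟩
  rintro ⟨f, hf, hfe⟩
  apply heY
  have := congrArg (Sym2.map (g⁻¹ • ·)) hfe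
  rw [map_smul_smul, map_smul_smul, inv_mul_cancel, map_one_smul, map_one_smul] at this
  rwa [← this]

/-- A path joining two vertices of a cylinder is contained in the cylinder. -/
theorem cyl_convex (hT : T.IsTree) (hact : ActsOn T G) (hinv : NoInversions T G)
    {E : Set (Subgroup G)} (hE : Admissible E) (hET : IsETree T G E) {Y : Set (Sym2 V)}
    (hY : IsCylinder T G Y) {a b : V} (ha : a ∈ cylVerts Y) (hb : b ∈ cylVerts Y)
    (p : T.Walk a b) (hp : p.IsPath) : ∀ f ∈ p.edges, f ∈ Y := by
  intro f hf
  obtain ⟨e₁, he₁, ha⟩ := ha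
  obtain ⟨e₂, he₂, hb⟩ := hb
  have hfT : f ∈ T.edgeSet := p.edges_subset_edgeSet hf
  have hle : edgeStab G e₁ ⊓ edgeStab G e₂ ≤ edgeStab G f := by
    rintro g ⟨h1, h2⟩
    have ga : actHom hact g a = a := smul_eq_of_mem_edge hinv (hY.2.1 he₁) ha h1
    have gb : actHom hact g b = b := smul_eq_of_mem_edge hinv (hY.2.1 he₂) hb h2
    have hinj : Function.Injective (actHom hact g) := MulAction.injective g
    have hq : ((p.map (actHom hact g)).copy ga gb).IsPath := by
      rw [SimpleGraph.Walk.isPath_copy]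
      exact SimpleGraph.Walk.map_isPath_of_injective hinj hp
    have := (hT.isAcyclic.subsingleton_path _ _).elim ⟨p, hp⟩ ⟨_, hq⟩
    have h3 : p = (p.map (actHom hact g)).copy ga gb := congrArg Subtype.val this
    have h4 : p.edges = p.edges.map (Sym2.map (g • ·)) := by
      conv_lhs => rw [h3]
      rw [SimpleGraph.Walk.edges_copy, SimpleGraph.Walk.edges_map]
      rfl
    have h5 : p.edges.map (Sym2.map (g • ·)) = p.edges.map id := by rw [← h4, List.map_id]
    exact (List.map_inj_left.1 h5) f hf
  have hc := hY.comm he₁ he₂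
  have hc2 : Subgroup.Commensurable (edgeStab G e₁ ⊓ edgeStab G e₂) (edgeStab G e₁) :=
    commens_inf (.refl _) hc.symm
  have hmem : edgeStab G e₁ ⊓ edgeStab G e₂ ∈ E := hE.2.1 _ (hET e₁ (hY.2.1 he₁)) _ hc2
  have hfin := hE.2.2 _ hmem _ (hET f hfT) hle
  have hc3 : Subgroup.Commensurable (edgeStab G e₁ ⊓ edgeStab G e₂) (edgeStab G f) := by
    refine ⟨hfin, ?_⟩
    rw [Subgroup.relIndex_eq_one.2 hle]
    exact one_ne_zero
  exact (hY.2.2 e₁ he₁ f hfT).2 (hc2.symm.trans hc3)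

theorem cylVerts_side (hT : T.IsTree) (hact : ActsOn T G) (hinv : NoInversions T G)
    {E : Set (Subgroup G)} (hE : Admissible E) (hET : IsETree T G E) {Y : Set (Sym2 V)}
    (hY : IsCylinder T G Y) {S : Set V} (hS : ∀ e ∈ Y, e ∉ cobdry T S)
    {a b : V} (ha : a ∈ cylVerts Y) (hb : b ∈ cylVerts Y) : a ∈ S ↔ b ∈ S := by
  obtain ⟨p, hp⟩ := (hT.existsUnique_path a b).exists
  exact mem_iff_of_walk p fun e he => hS e (cyl_convex hT hact hinv hE hET hY ha hb p hp e he)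

theorem exit_point {Z : Set (Sym2 V)} {w u : V} (p : T.Walk w u) (hw : w ∈ cylVerts Z) :
    u ∈ cylVerts Z ∨ ∃ a ∈ p.support, a ∈ cylBoundary T Z := by
  induction p with
  | nil => exact Or.inl hw
  | @cons x y z hxy q ih =>
    by_cases hZ : s(x, y) ∈ Z
    · rcases ih ⟨_, hZ, by simp⟩ with h | ⟨a, ha, hb⟩
      · exact Or.inl h
      · exact Or.inr ⟨a, by simp [ha], hb⟩
    · exact Or.inr ⟨x, by simp, hw, _, hxy, by simp, hZ⟩

theorem boundary_of_two {Y Z : Set (Sym2 V)} (hY : IsCylinder T G Y) (hZ : IsCylinder T G Z)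
    {u : V} (hu : u ∈ cylBoundary T Y) (huZ : u ∈ cylVerts Z) : u ∈ cylBoundary T Z := by
  by_cases h : Y = Z
  · rwa [← h]
  · obtain ⟨⟨e, he, hue⟩, -⟩ := hu
    exact ⟨huZ, e, hY.2.1 he, hue, fun hc => h (hY.eq_of_mem hZ he hc)⟩

/-- By minimality, every vertex of a cylinder is between two boundary points. -/
theorem cyl_hull (hT : T.IsTree) (hact : ActsOn T G) (hmin : MinimalAction T G)
    {Y : Set (Sym2 V)} (hY : IsCylinder T G Y) {u : V} (hu : u ∈ cylBoundary T Y)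
    {Z : Set (Sym2 V)} (hZ : IsCylinder T G Z) {w : V} (hw : w ∈ cylVerts Z) :
    ∃ a ∈ cylBoundary T Z, ∃ b ∈ cylBoundary T Z, BB T a w b := by
  have key := hmin {w | ∀ Z, IsCylinder T G Z → w ∈ cylVerts Z →
    ∃ a ∈ cylBoundary T Z, ∃ b ∈ cylBoundary T Z, BB T a w b} ?_ ?_ ?_
  · have : w ∈ (Set.univ : Set V) := trivial
    rw [← key] at this
    exact this Z hZ hw
  · exact ⟨u, fun Z hZ huZ => ⟨u, boundary_of_two hY hZ hu huZ, u,
      boundary_of_two hY hZ hu huZ, bb_left _ _⟩⟩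
  · intro g a ha Z hZ hZa
    have h1 := mem_cylVerts_smul (g := g⁻¹) hZa
    rw [inv_smul_smul] at h1
    obtain ⟨x, hx, y, hy, hxy⟩ := ha _ (hZ.smul hact g⁻¹) h1
    have hx := mem_cylBoundary_smul hact (g := g) hx
    have hy := mem_cylBoundary_smul hact (g := g) hy
    rw [image_inv_image] at hx hy
    exact ⟨_, hx, _, hy, hxy.smul hact g⟩
  · intro u hu v hv w hw Z hZ hwZ
    rw [btw_iff_bb] at hw
    have side : ∀ x, (∀ Z, IsCylinder T G Z → x ∈ cylVerts Z →
        ∃ a ∈ cylBoundary T Z, ∃ b ∈ cylBoundary T Z, BB T a x b) →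
        ∃ x' ∈ cylBoundary T Z, BB T w x x' ∨ BB T w x' x := by
      intro x hx
      obtain ⟨p, hp⟩ := (hT.existsUnique_path w x).exists
      rcases exit_point p hwZ with h | ⟨a, ha, haZ⟩
      · obtain ⟨a, ha, b, hb, hab⟩ := hx Z hZ h
        rcases hab.sep w with h | h
        · exact ⟨a, ha, Or.inl h⟩
        · exact ⟨b, hb, Or.inl h⟩
      · exact ⟨a, haZ, Or.inr (bb_of_path hT hp ha)⟩
    by_cases hwb : w ∈ cylBoundary T Z
    · exact ⟨w, hwb, w, hwb, bb_left _ _⟩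
    by_cases hwu : w = u
    · subst hwu; exact hu Z hZ hwZ
    by_cases hwv : w = v
    · subst hwv; exact hv Z hZ hwZ
    -- `x'` is in the same branch at `w` as `x`
    have same : ∀ x x', w ≠ x → w ≠ x' → (BB T w x x' ∨ BB T w x' x) → ¬ BB T x w x' := by
      intro x x' h1 h2 h hb
      rcases h with h | h
      · have h3 := hb.symm.dist_lt hT h1
        have h4 := h.symm.dist_lt hT (Ne.symm h1)
        omega
      · have h3 := hb.dist_lt hT h2
        have h4 := h.symm.dist_lt hT (Ne.symm h2)
        omega
    obtain ⟨a, ha, ha'⟩ := side u hu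
    obtain ⟨b, hb, hb'⟩ := side v hv
    have hwa : w ≠ a := fun h => hwb (h ▸ ha)
    have hwb' : w ≠ b := fun h => hwb (h ▸ hb)
    have n1 := same u a hwu hwa ha'
    have n2 := same v b hwv hwb' hb'
    refine ⟨a, ha, b, hb, ?_⟩
    have h1 : BB T a w v := by
      rcases hw.sep a with h | h
      · exact absurd h.symm n1
      · exact h
    rcases h1.sep b with h | h
    · exact h.symm
    · exact absurd h.symm n2

theorem exists_two_boundary (hT : T.IsTree) (hact : ActsOn T G) (hmin : MinimalAction T G)
    {Y : Set (Sym2 V)} (hY : IsCylinder T G Y) {u : V} (hu : u ∈ cylBoundary T Y)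
    {Z : Set (Sym2 V)} (hZ : IsCylinder T G Z) : BigBoundary T Z ∨ TwoBoundary T Z := by
  have h2 : ∃ a ∈ cylBoundary T Z, ∃ b ∈ cylBoundary T Z, a ≠ b := by
    by_contra! hc
    obtain ⟨e, he⟩ := hZ.1
    induction e using Sym2.ind with
    | _ x y =>
      obtain ⟨a, ha, b, hb, h1⟩ := cyl_hull hT hact hmin hY hu hZ (w := x) ⟨_, he, by simp⟩
      obtain ⟨a', ha', b', hb', h2⟩ := cyl_hull hT hact hmin hY hu hZ (w := y) ⟨_, he, by simp⟩
      have e1 := hc a ha b hb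
      have e2 := hc a ha a' ha'
      have e3 := hc a ha b' hb'
      subst e1 e2 e3
      have := h1.eq_of_same.trans h2.eq_of_same.symm
      have hadj : T.Adj x y := hZ.2.1 he
      exact hadj.ne this
  obtain ⟨a, ha, b, hb, hab⟩ := h2
  by_cases h : ∃ c ∈ cylBoundary T Z, c ≠ a ∧ c ≠ b
  · obtain ⟨c, hc, hca, hcb⟩ := h
    exact Or.inl ⟨a, b, c, ha, hb, hc, hab, hca.symm, hcb.symm⟩
  · push Not at h
    refine Or.inr ⟨a, b, hab, ?_⟩
    ext x
    simp only [Set.mem_insert_iff, Set.mem_singleton_iff]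
    constructor
    · intro hx
      by_cases hxa : x = a
      · exact Or.inl hxa
      · exact Or.inr (h x hx hxa)
    · rintro (rfl | rfl) <;> assumption

theorem cyl_of_two (hT : T.IsTree) (hact : ActsOn T G) (hmin : MinimalAction T G)
    (hval3 : ∀ w : V, ∃ a b c : V, a ≠ b ∧ a ≠ c ∧ b ≠ c ∧ T.Adj w a ∧ T.Adj w b ∧ T.Adj w c)
    {Y : Set (Sym2 V)} (hY : IsCylinder T G Y) {a b : V} (hY2 : cylBoundary T Y = {a, b}) :
    ∀ e ∈ Y, e = s(a, b) := by
  have hu : a ∈ cylBoundary T Y := by simp [hY2]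
  have hull : ∀ w ∈ cylVerts Y, BB T a w b := by
    intro w hw
    obtain ⟨x, hx, y, hy, h⟩ := cyl_hull hT hact hmin hY hu hY hw
    rw [hY2] at hx hy
    simp only [Set.mem_insert_iff, Set.mem_singleton_iff] at hx hy
    rcases hx with rfl | rfl <;> rcases hy with rfl | rfl
    · rw [h.eq_of_same]; exact bb_left _ _
    · exact h
    · exact h.symm
    · rw [h.eq_of_same]; exact bb_right _ _
  have hverts : ∀ w ∈ cylVerts Y, w = a ∨ w = b := by
    intro w hw
    by_contra hc
    have hwb : w ∉ cylBoundary T Y := by rw [hY2]; simpa using hc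
    have hnb : ∀ n, T.Adj w n → BB T a w n → ¬ BB T b w n := by
      intro n hn h1 h2
      have hnY : s(w, n) ∈ Y := by
        by_contra hcc
        exact hwb ⟨hw, _, hn, by simp, hcc⟩
      have h3 := hull n ⟨_, hnY, by simp⟩
      rcases h3.sep w with h | h
      · have := h1.dist_lt hT hn.ne
        have := h.symm.dist_lt hT hn.ne'
        omega
      · have := h2.dist_lt hT hn.ne
        have := h.symm.dist_lt hT hn.ne'
        omega
    obtain ⟨n₁, n₂, n₃, h12, h13, h23, a1, a2, a3⟩ := hval3 w
    have b12 := bb_nbrs hT a1 a2 h12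
    have b13 := bb_nbrs hT a1 a3 h13
    have b23 := bb_nbrs hT a2 a3 h23
    have := hnb _ a1
    have := hnb _ a2
    have := hnb _ a3
    have := b12.sep a
    have := b13.sep a
    have := b23.sep a
    have := b12.sep b
    have := b13.sep b
    have := b23.sep b
    tauto
  intro e he
  induction e using Sym2.ind with
  | _ x y =>
    have hadj : T.Adj x y := hY.2.1 he
    have := hadj.ne
    rcases hverts x ⟨_, he, by simp⟩ with rfl | rfl <;>
    rcases hverts y ⟨_, he, by simp⟩ with rfl | rfl
    · exact absurd rfl this
    · rfl
    · exact Sym2.eq_swap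
    · exact absurd rfl this

/-- An infinite set with finite coboundary contains orbit points far away from `p`. -/
theorem exists_far_orbit (hT : T.IsTree) (hact : ActsOn T G) (hmin : MinimalAction T G)
    (hval3 : ∀ w : V, ∃ a b c : V, a ≠ b ∧ a ≠ c ∧ b ≠ c ∧ T.Adj w a ∧ T.Adj w b ∧ T.Adj w c)
    (v₀ : V) {S : Set V} (hS : ¬ S.Finite) (hc : (cobdry T S).Finite) (p : V) (n : ℕ) :
    ∃ g : G, g • v₀ ∈ S ∧ n ≤ T.dist p (g • v₀) := by
  have key := hmin {x | ∃ g h : G, BB T (g • v₀) x (h • v₀)} ?_ ?_ ?_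
  · obtain ⟨w, hw⟩ := exists_branch hT hS hc p
    obtain ⟨w', h1, h2⟩ := exists_far hT hval3 p w n
    have : w' ∈ (Set.univ : Set V) := trivial
    rw [← key] at this
    obtain ⟨g, h, hgh⟩ := this
    rcases hgh.sep p with h3 | h3
    · exact ⟨g, hw _ (h1.trans h3), h2.trans (h3.dist_le hT)⟩
    · exact ⟨h, hw _ (h1.trans h3), h2.trans (h3.dist_le hT)⟩
  · exact ⟨v₀, 1, 1, by simpa using bb_left _ _⟩
  · rintro k x ⟨g, h, hgh⟩
    refine ⟨k * g, k * h, ?_⟩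
    rw [mul_smul, mul_smul]
    exact hgh.smul hact k
  · rintro u ⟨a, b, hab⟩ v ⟨c, d, hcd⟩ w hw
    rw [btw_iff_bb] at hw
    rcases hw.sep (a • v₀) with h | h
    · exact ⟨a, b, h.trans hab⟩
    · rcases h.sep (c • v₀) with h' | h'
      · exact ⟨c, a, h'⟩
      · exact ⟨c, d, h'.trans hcd⟩

end ActionLemmas

end SSRN
namespace SSRN

section AILemmas
variable {G V : Type*} [Group G] [MulAction G V] {T : SimpleGraph V} {E : Set (Subgroup G)}

/-- The standing hypotheses. -/
structure Setup (T : SimpleGraph V) (E : Set (Subgroup G)) : Prop where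
  hT : T.IsTree
  hact : ActsOn T G
  hinv : NoInversions T G
  hE : Admissible E
  hET : IsETree T G E
  hmin : MinimalAction T G
  hval3 : ∀ w : V, ∃ a b c : V, a ≠ b ∧ a ≠ c ∧ b ≠ c ∧ T.Adj w a ∧ T.Adj w b ∧ T.Adj w c

theorem lemF (st : Setup T E) {Y : Set (Sym2 V)} (hY : IsCylinder T G Y) {e : Sym2 V}
    (he : e ∈ Y) {S : Set V} (hS : IsSpecialForest T S Y) (a b : V) :
    HFin (edgeStab G e) {g : G | ¬ (g • a ∈ S ↔ g • b ∈ S)} := by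
  obtain ⟨p⟩ := st.hT.connected a b
  have hfin : ({q | q ∈ p.edges} ×ˢ cobdry T S).Finite :=
    (List.finite_toSet p.edges).prod hS.1
  refine (hFin_biUnion hfin (fun i => {g : G | Sym2.map (g • ·) i.1 = i.2}) ?_).mono ?_
  · rintro ⟨q, f⟩ ⟨-, hf⟩
    have hfY : f ∈ Y := hS.2 hf
    refine HFin.comm (K := edgeStab G f) ?_ (hY.comm he hfY)
    by_cases hne : ∃ g₀ : G, Sym2.map (g₀ • ·) q = f
    · obtain ⟨g₀, hg₀⟩ := hne
      rw [hFin_iff]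
      refine ⟨{g₀}, fun x hx => ⟨g₀, by simp, ?_⟩⟩
      have hx : Sym2.map (x • ·) q = f := hx
      rw [mem_edgeStab]
      conv_lhs => rw [← hg₀]
      rw [map_smul_smul, inv_mul_cancel_right, hx]
    · refine hFin_empty.mono ?_
      intro x hx
      exact hne ⟨x, hx⟩
  · intro g hg
    obtain ⟨f, hf, hfS⟩ := exists_edge_of_walk (p.map (actHom st.hact g)) (S := S) hg
    rw [SimpleGraph.Walk.edges_map, List.mem_map] at hf
    obtain ⟨q, hq, hqf⟩ := hf
    simp only [Set.mem_iUnion]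
    exact ⟨(q, f), ⟨hq, hfS⟩, hqf⟩

theorem exists_small {Y : Set (Sym2 V)} (hY : IsCylinder T G Y) {e : Sym2 V} (he : e ∈ Y)
    {D : Set (Sym2 V)} (hD : D.Finite) (hDY : D ⊆ Y) :
    ∃ K : Subgroup G, Subgroup.Commensurable K (edgeStab G e) ∧ ∀ f ∈ D, K ≤ edgeStab G f := by
  induction D, hD using Set.Finite.induction_on with
  | empty => exact ⟨edgeStab G e, .refl _, by simp⟩
  | @insert a s _ _ ih =>
    obtain ⟨K, h1, h2⟩ := ih fun x hx => hDY (by simp [hx])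
    refine ⟨K ⊓ edgeStab G a, commens_inf h1 (hY.comm (hDY (by simp)) he), ?_⟩
    intro f hf
    rcases hf with rfl | hf
    · exact inf_le_right
    · exact inf_le_left.trans (h2 f hf)

theorem left_inv (st : Setup T E) {S : Set V} {h : G} (hh : ∀ f ∈ cobdry T S, h ∈ edgeStab G f)
    (x : V) : h • x ∈ S ↔ x ∈ S := by
  by_cases hemp : cobdry T S = ∅
  · constructor
    · exact trivial_of_cobdry_empty st.hT hemp _
    · exact trivial_of_cobdry_empty st.hT hemp _
  · obtain ⟨f, hf⟩ := Set.nonempty_iff_ne_empty.2 hemp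
    induction f using Sym2.ind with
    | _ a b =>
      have ha : h • a = a :=
        (smul_eq_of_mem_edgeStab st.hinv (mem_cobdry.1 hf).1 (hh _ hf)).1
      have key : ∀ (c : V) (p : T.Walk c x), (h • c ∈ S ↔ c ∈ S) → (h • x ∈ S ↔ x ∈ S) := by
        intro c p
        induction p with
        | nil => exact id
        | @cons c d x hcd q ih =>
          intro hc
          apply ih
          by_cases h1 : s(c, d) ∈ cobdry T S
          · rw [(smul_eq_of_mem_edgeStab st.hinv hcd (hh _ h1)).2]
          · by_cases h2 : s(h • c, h • d) ∈ cobdry T S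
            · have := (smul_eq_of_mem_edgeStab st.hinv (st.hact h _ _ hcd) (hh _ h2)).2
              rw [smul_left_cancel_iff] at this
              rw [this]
            · rw [mem_cobdry] at h1 h2
              have := st.hact h _ _ hcd
              tauto
      obtain ⟨p⟩ := st.hT.connected a x
      exact key a p (by rw [ha])

theorem exists_AI (st : Setup T E) (v₀ : V) {Y : Set (Sym2 V)} (hY : IsCylinder T G Y)
    {e : Sym2 V} (he : e ∈ Y) {S : Set V} (hS : IsSpecialForest T S Y) :
    ∃ K : Subgroup G, Subgroup.Commensurable K (edgeStab G e) ∧ IsAI K (XS G v₀ S) := by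
  obtain ⟨K, h1, h2⟩ := exists_small hY he hS.1 hS.2
  refine ⟨K, h1, isAI_iff.2 ⟨fun h hh x => ?_, fun s => ?_⟩⟩
  · have := left_inv st (S := S) (h := h) (fun f hf => h2 f hf hh) (x • v₀)
    rw [← mul_smul] at this
    exact this
  · refine ((lemF st hY he hS (s • v₀) v₀).comm h1).mono ?_
    intro g hg
    simp only [Set.mem_ofPred_eq, XS, mul_smul] at hg ⊢
    exact hg

theorem not_hFin (st : Setup T E) (v₀ : V) {e : Sym2 V} (he : e ∈ T.edgeSet) {S : Set V}
    (hS : ¬ S.Finite) (hc : (cobdry T S).Finite) : ¬ HFin (edgeStab G e) (XS G v₀ S) := by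
  intro h
  induction e using Sym2.ind with
  | _ a b =>
    rw [hFin_iff] at h
    obtain ⟨F, hF⟩ := h
    obtain ⟨g, hg, hd⟩ := exists_far_orbit st.hT st.hact st.hmin st.hval3 v₀ hS hc a
      (F.sup (fun f => T.dist a (f • v₀)) + 1)
    obtain ⟨f, hf, hgf⟩ := hF g hg
    have h1 := (smul_eq_of_mem_edgeStab st.hinv he hgf).1
    have h2 := dist_smul_le st.hT st.hact (g * f⁻¹) a (f • v₀)
    rw [h1, smul_smul, inv_mul_cancel_right] at h2
    have h3 : T.dist a (f • v₀) ≤ F.sup (fun f => T.dist a (f • v₀)) :=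
      Finset.le_sup (f := fun f => T.dist a (f • v₀)) hf
    exact absurd (hd.trans (h2.trans h3)) (Nat.not_succ_le_self _)

theorem not_hFin_univ (st : Setup T E) (v₀ : V) {e : Sym2 V} (he : e ∈ T.edgeSet)
    (hinf : ¬ (Set.univ : Set V).Finite) : ¬ HFin (edgeStab G e) (Set.univ : Set G) := by
  have h0 : cobdry T (Set.univ : Set V) = ∅ := by
    rw [Set.eq_empty_iff_forall_notMem]
    rintro _ ⟨-, u, v, -, -, h⟩
    exact h trivial
  have := not_hFin (G := G) st v₀ he hinf (by rw [h0]; exact Set.finite_empty)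
  intro h
  exact this (h.mono (Set.subset_univ _))

/-- Non-trivial forests give non-trivial almost invariant sets. -/
theorem nontriv_of_forest (st : Setup T E) (v₀ : V) {Y : Set (Sym2 V)} (hY : IsCylinder T G Y)
    {e : Sym2 V} (he : e ∈ Y) {S : Set V} (hS : IsSpecialForest T S Y) (hnt : NontrivForest S) :
    ∃ K : Subgroup G, Subgroup.Commensurable K (edgeStab G e) ∧ NontrivAI K (XS G v₀ S) := by
  obtain ⟨K, hK, hAI⟩ := exists_AI st v₀ hY he hS
  refine ⟨K, hK, hAI, fun h => ?_, fun h => ?_⟩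
  · exact not_hFin st v₀ (hY.2.1 he) hnt.1 hS.1 (h.comm hK.symm)
  · exact not_hFin st v₀ (hY.2.1 he) hnt.2 hS.compl.1 (h.comm hK.symm)

theorem mem_BCT {v₀ : V} {Y : Set (Sym2 V)} (hY : IsCylinder T G Y) (hT : T.IsTree)
    (H : Subgroup G) {S : Set V} (hS : IsSpecialForest T S Y) : XS G v₀ S ∈ BCT T v₀ Y H := by
  rintro F ⟨h1, h2, h3, -⟩
  refine boolean_gen hT (fun A => XS G v₀ A ∈ F) (fun A hA => h2 _ hA)
    (fun A B hA hB => h3 _ hA _ hB) ?_ (cobdry T S) hS.1 ?_ S subset_rfl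
  · obtain ⟨e, he⟩ := hY.1
    induction e using Sym2.ind with
    | _ x y =>
      have h4 := h1 x y (hY.2.1 he) he
      have h5 := h3 _ h4 _ (h2 _ h4)
      rw [Set.inter_compl_self] at h5
      exact h5
  · intro x y hxy h
    exact h1 x y hxy (hS.2 h)

theorem symmDiff_sub {X X' X'' : Set G} : X ∆ X'' ⊆ X ∆ X' ∪ X' ∆ X'' := by
  intro x hx
  simp only [Set.mem_symmDiff, Set.mem_union] at *
  tauto

theorem exists_forest_of_BCT {v₀ : V} {Y : Set (Sym2 V)} {H : Subgroup G} {X : Set G}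
    (hX : X ∈ BCT T v₀ Y H) : ∃ S, IsSpecialForest T S Y ∧ HFin H (X ∆ XS G v₀ S) := by
  refine hX {X | ∃ S, IsSpecialForest T S Y ∧ HFin H (X ∆ XS G v₀ S)} ⟨?_, ?_, ?_, ?_⟩
  · intro u v huv hY
    exact ⟨_, halfTree_special hY, by simpa [Ze] using hFin_empty⟩
  · rintro X ⟨S, h1, h2⟩
    refine ⟨Sᶜ, h1.compl, h2.mono ?_⟩
    intro x hx
    simp only [Set.mem_symmDiff, XS, Set.mem_compl_iff, Set.mem_ofPred_eq] at *
    tauto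
  · rintro X ⟨S, h1, h2⟩ X' ⟨S', h1', h2'⟩
    refine ⟨S ∩ S', h1.inter h1', (h2.union h2').mono ?_⟩
    intro x hx
    simp only [Set.mem_symmDiff, XS, Set.mem_union, Set.mem_inter_iff, Set.mem_ofPred_eq] at *
    tauto
  · rintro X ⟨S, h1, h2⟩ X' h
    refine ⟨S, h1, (h.union h2).mono ?_⟩
    rw [symmDiff_comm X X']
    exact symmDiff_sub

theorem BCT.compl {v₀ : V} {Y : Set (Sym2 V)} {H : Subgroup G} {X : Set G}
    (hX : X ∈ BCT T v₀ Y H) : Xᶜ ∈ BCT T v₀ Y H :=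
  fun F hF => hF.2.1 X (hX F hF)

theorem lemG (st : Setup T E) {v₀ : V} (hinf : ¬ (Set.univ : Set V).Finite)
    {Y : Set (Sym2 V)} (hY : IsCylinder T G Y)
    {e : Sym2 V} (he : e ∈ Y) {X : Set G} (hX : X ∈ BCT T v₀ Y (edgeStab G e))
    {H : Subgroup G} (hH : NontrivAI H X) : Subgroup.Commensurable H (edgeStab G e) := by
  obtain ⟨S, hS, hXS⟩ := exists_forest_of_BCT hX
  have hu := not_hFin_univ (G := G) st v₀ (hY.2.1 he) hinf
  obtain ⟨K, hK, hAI⟩ := exists_AI st v₀ hY he hS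
  by_cases h1 : HFin (edgeStab G e) (XS G v₀ S)
  · refine (not_nontriv_of_hFin hu ((h1.union hXS).mono ?_) hH).elim
    intro x hx
    simp only [Set.mem_symmDiff, Set.mem_union] at *
    tauto
  by_cases h2 : HFin (edgeStab G e) (XS G v₀ S)ᶜ
  · refine (not_nontriv_of_hFin hu ((h2.union hXS).mono ?_) hH.compl).elim
    intro x hx
    simp only [Set.mem_symmDiff, Set.mem_union, Set.mem_compl_iff] at *
    tauto
  have hnt : NontrivAI K (XS G v₀ S) :=
    ⟨hAI, fun h => h1 (h.comm hK.symm), fun h => h2 (h.comm hK.symm)⟩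
  have h3 : HFin K ((XS G v₀ S) ∆ X) := by
    rw [symmDiff_comm]; exact hXS.comm hK
  exact (commens_of_equiv hnt hH h3).symm.trans hK

theorem no_corner (st : Setup T E) {v₀ : V} {Y Y' : Set (Sym2 V)}
    (hY : IsCylinder T G Y) (hY' : IsCylinder T G Y') (hne : Y ≠ Y')
    {e e' : Sym2 V} (he : e ∈ Y) (he' : e' ∈ Y') {X X' : Set G} {S S' : Set V}
    (hS : IsSpecialForest T S Y) (hS' : IsSpecialForest T S' Y')
    (hX : HFin (edgeStab G e) (X ∆ XS G v₀ S)) (hX' : HFin (edgeStab G e') (X' ∆ XS G v₀ S'))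
    (h1 : ∀ y ∈ cylVerts Y, y ∉ S') (h2 : ∀ y ∈ cylVerts Y', y ∉ S) :
    HFin (edgeStab G e) (X ∩ X') := by
  have hdis : S ∩ S' = ∅ := by
    have hc : cobdry T (S ∩ S') = ∅ := by
      rw [Set.eq_empty_iff_forall_notMem]
      rintro _ ⟨hf, x, y, rfl, ⟨hx, hx'⟩, hy⟩
      have hxy : T.Adj x y := hf
      by_cases hyS : y ∈ S
      · have : s(x, y) ∈ cobdry T S' := mem_cobdry.2 ⟨hxy, fun h => hy ⟨hyS, h.1 hx'⟩⟩
        exact h2 x ⟨_, hS'.2 this, by simp⟩ hx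
      · have : s(x, y) ∈ cobdry T S := mem_cobdry.2 ⟨hxy, fun h => hyS (h.1 hx)⟩
        exact h1 x ⟨_, hS.2 this, by simp⟩ hx'
    rw [Set.eq_empty_iff_forall_notMem]
    intro x hx
    induction e using Sym2.ind with
    | _ a b =>
      exact h1 a ⟨_, he, by simp⟩ (trivial_of_cobdry_empty st.hT hc a hx).2
  obtain ⟨F, hF⟩ := hFin_iff.1 hX'
  induction e' using Sym2.ind with
  | _ p q =>
    have key : HFin (edgeStab G e) (⋃ f ∈ (F : Set G),
        {g : G | ¬ (g • v₀ ∈ S ↔ g • (f⁻¹ • p) ∈ S)}) :=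
      hFin_biUnion F.finite_toSet _ fun f _ => lemF st hY he hS _ _
    refine (hX.union key).mono ?_
    rintro g ⟨hg, hg'⟩
    by_cases hgS : g • v₀ ∈ S
    · right
      have hgS' : g • v₀ ∉ S' := fun h => by
        have : g • v₀ ∈ S ∩ S' := ⟨hgS, h⟩
        rw [hdis] at this
        exact this
      obtain ⟨f, hf, hgf⟩ := hF g (Or.inl ⟨hg', hgS'⟩)
      have h3 := (smul_eq_of_mem_edgeStab st.hinv (hY'.2.1 he') hgf).1
      simp only [Set.mem_iUnion]
      refine ⟨f, hf, ?_⟩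
      have h4 : g • (f⁻¹ • p) ∉ S := by
        rw [smul_smul, h3]
        exact h2 p ⟨_, he', by simp⟩
      intro h
      exact h4 (h.1 hgS)
    · exact Or.inl (Or.inl ⟨hg, hgS⟩)

theorem cyl_side (st : Setup T E) {Y Y' : Set (Sym2 V)}
    (hY : IsCylinder T G Y) (hY' : IsCylinder T G Y') (hne : Y ≠ Y') {S' : Set V}
    (hS' : IsSpecialForest T S' Y') :
    (∀ y ∈ cylVerts Y, y ∉ S') ∨ (∀ y ∈ cylVerts Y, y ∉ S'ᶜ) := by
  have hd : ∀ f ∈ Y, f ∉ cobdry T S' := fun f hf hc => hne (hY.eq_of_mem hY' hf (hS'.2 hc))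
  by_contra! h
  obtain ⟨⟨a, ha, ha'⟩, ⟨b, hb, hb'⟩⟩ := h
  exact hb' ((cylVerts_side st.hT st.hact st.hinv st.hE st.hET hY hd ha hb).1 ha')

theorem compl_symmDiff_compl' {X X' : Set G} : Xᶜ ∆ X'ᶜ = X ∆ X' := by
  ext x
  simp only [Set.mem_symmDiff, Set.mem_compl_iff]
  tauto

theorem eq_of_crosses (st : Setup T E) {v₀ : V} (hinf : ¬ (Set.univ : Set V).Finite)
    {Y Y' : Set (Sym2 V)}
    (hY : IsCylinder T G Y) (hY' : IsCylinder T G Y')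
    {e e' : Sym2 V} (he : e ∈ Y) (he' : e' ∈ Y') {X X' : Set G}
    (hX : X ∈ BCT T v₀ Y (edgeStab G e)) (hX' : X' ∈ BCT T v₀ Y' (edgeStab G e'))
    (h : CrossesAny X X') : Y = Y' := by
  by_contra hne
  obtain ⟨H, K, hH, hK, c1, c2, c3, c4⟩ := h
  have hcomm := lemG st hinf hY he hX hH
  obtain ⟨S, hS, hXS⟩ := exists_forest_of_BCT hX
  obtain ⟨S', hS', hXS'⟩ := exists_forest_of_BCT hX'
  have hXSc : HFin (edgeStab G e) (Xᶜ ∆ XS G v₀ Sᶜ) := by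
    have : XS G v₀ Sᶜ = (XS G v₀ S)ᶜ := rfl
    rwa [this, compl_symmDiff_compl']
  have hXSc' : HFin (edgeStab G e') (X'ᶜ ∆ XS G v₀ S'ᶜ) := by
    have : XS G v₀ S'ᶜ = (XS G v₀ S')ᶜ := rfl
    rwa [this, compl_symmDiff_compl']
  rcases cyl_side st hY hY' hne hS' with h1 | h1 <;>
  rcases cyl_side st hY' hY (Ne.symm hne) hS with h2 | h2
  · exact c1 ((no_corner st hY hY' hne he he' hS hS' hXS hXS' h1 h2).comm hcomm)
  · exact c3 ((no_corner st hY hY' hne he he' hS.compl hS' hXSc hXS' h1 h2).comm hcomm)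
  · exact c2 ((no_corner st hY hY' hne he he' hS hS'.compl hXS hXSc' h1 h2).comm hcomm)
  · exact c4 ((no_corner st hY hY' hne he he' hS.compl hS'.compl hXSc hXSc' h1 h2).comm hcomm)

theorem eq_of_samePair (st : Setup T E) {v₀ : V} (hinf : ¬ (Set.univ : Set V).Finite)
    {Y Y' : Set (Sym2 V)}
    (hY : IsCylinder T G Y) (hY' : IsCylinder T G Y')
    {e e' : Sym2 V} (he : e ∈ Y) (he' : e' ∈ Y') {X X' : Set G}
    (hX : X ∈ BCT T v₀ Y (edgeStab G e)) (hX' : X' ∈ BCT T v₀ Y' (edgeStab G e'))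
    {K : Subgroup G} (hK : NontrivAI K X')
    (h : SamePair X X') : Y = Y' := by
  obtain ⟨H, hH, hc⟩ := h
  have h1 := lemG st hinf hY he hX hH
  have h2 := lemG st hinf hY' he' hX' hK
  have h3 : Subgroup.Commensurable H K := by
    rcases hc with hc | hc
    · exact commens_of_equiv hH hK hc
    · exact commens_of_equiv hH hK.compl hc
  exact hY.eq_of_comm hY' he he' ((h1.symm.trans h3).trans h2)

/-- `X` is based on the cylinder `Y`. -/
def BasedOn (T : SimpleGraph V) (v₀ : V) (Y : Set (Sym2 V)) (X : Set G) : Prop :=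
  IsCylinder T G Y ∧ ∃ e ∈ Y, X ∈ BCT T v₀ Y (edgeStab G e)

theorem eq_of_ccStep (st : Setup T E) {v₀ : V} (hinf : ¬ (Set.univ : Set V).Finite)
    {X X' : Set G} (h : ccStep T G v₀ X X') {Y Y' : Set (Sym2 V)}
    (hX : BasedOn T v₀ Y X) (hX' : BasedOn T v₀ Y' X') : Y = Y' := by
  obtain ⟨hY, e, he, hX⟩ := hX
  obtain ⟨hY', e', he', hX'⟩ := hX'
  obtain ⟨h1, ⟨-, K, hK⟩, h3 | h3⟩ := h
  · exact eq_of_crosses st hinf hY hY' he he' hX hX' h3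
  · exact eq_of_samePair st hinf hY hY' he he' hX hX' hK h3

theorem basedOn_unique (st : Setup T E) {v₀ : V} (hinf : ¬ (Set.univ : Set V).Finite)
    {X : Set G} (h : X ∈ NontrivB T G v₀) {Y Y' : Set (Sym2 V)}
    (hX : BasedOn T v₀ Y X) (hX' : BasedOn T v₀ Y' X) : Y = Y' := by
  refine eq_of_ccStep st hinf ⟨h, h, Or.inr ?_⟩ hX hX'
  obtain ⟨-, H, hH⟩ := h
  exact ⟨H, hH, Or.inl (by simpa using hFin_empty)⟩

theorem eq_of_ccRel (st : Setup T E) {v₀ : V} (hinf : ¬ (Set.univ : Set V).Finite)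
    {X X' : Set G} (h : ccRel T G v₀ X X') :
    X = X' ∨ (X ∈ NontrivB T G v₀ ∧ X' ∈ NontrivB T G v₀ ∧
      ∀ Y Y' : Set (Sym2 V), BasedOn T v₀ Y X → BasedOn T v₀ Y' X' → Y = Y') := by
  induction h with
  | rel x y h => exact Or.inr ⟨h.1, h.2.1, fun Y Y' h1 h2 => eq_of_ccStep st hinf h h1 h2⟩
  | refl x => exact Or.inl rfl
  | symm x y _ ih =>
    rcases ih with rfl | ⟨h1, h2, h3⟩
    · exact Or.inl rfl
    · exact Or.inr ⟨h2, h1, fun Y Y' h h' => (h3 _ _ h' h).symm⟩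
  | trans x y z _ _ ih1 ih2 =>
    rcases ih1 with rfl | ⟨h1, h2, h3⟩
    · exact ih2
    rcases ih2 with rfl | ⟨h1', h2', h3'⟩
    · exact Or.inr ⟨h1, h2, h3⟩
    · refine Or.inr ⟨h1, h2', fun Y Y' h h' => ?_⟩
      obtain ⟨Z, hZ⟩ := h2.1
      exact (h3 _ _ h hZ).trans (h3' _ _ hZ h')

theorem ccOf_eq {v₀ : V} {X X' : Set G} (h : X' ∈ ccOf T G v₀ X) :
    ccOf T G v₀ X = ccOf T G v₀ X' := by
  have h : Relation.EqvGen (ccStep T G v₀) X X' := h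
  ext Z
  constructor
  · intro hZ
    exact (h.symm).trans _ _ _ hZ
  · intro hZ
    exact h.trans _ _ _ hZ

/-- Value of `Φ` on the class of a non-trivial special forest. -/
theorem phi_value (st : Setup T E) {v₀ : V} {Y : Set (Sym2 V)} (hY : IsCylinder T G Y)
    {u : V} (hu : u ∈ cylBoundary T Y)
    {S' : Set V} {YS' : Set (Sym2 V)} (hYS' : IsCylinder T G YS')
    (hS' : IsSpecialForest T S' YS') (hnt : NontrivForest S')
    {Φ : Set (Set G) → TcSubV V} (hΦ : PhiSpec T G v₀ Φ)
    (hperi : ∀ (Z : Set (Sym2 V)) (v : V), IsCylinder T G Z → v ∈ cylBoundary T Z →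
      FiniteValenceIn Z v → IsSpecialForest T (periForest T Z v) Z) :
    Φ (ccOf T G v₀ (XS G v₀ S')) = tcY YS' ∨
    ∃ v ∈ cylBoundary T YS', BigBoundary T YS' ∧
      ccOf T G v₀ (XS G v₀ S') = ccOf T G v₀ (XvY T G v₀ YS' v) ∧
      Φ (ccOf T G v₀ (XS G v₀ S')) = tcMid v YS' := by
  have hinf : ¬ (Set.univ : Set V).Finite := fun h => hnt.1 (h.subset (Set.subset_univ _))
  obtain ⟨e, he⟩ := hYS'.1
  obtain ⟨K, hK, hKX⟩ := nontriv_of_forest st v₀ hYS' he hS' hnt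
  have hbase : BasedOn T v₀ YS' (XS G v₀ S') := ⟨hYS', e, he, mem_BCT hYS' st.hT _ hS'⟩
  have hNB : XS G v₀ S' ∈ NontrivB T G v₀ := ⟨⟨YS', hbase⟩, K, hKX⟩
  by_cases hp : PeripheralCCC T G v₀ (ccOf T G v₀ (XS G v₀ S'))
  · obtain ⟨Z, v, hZ, hv, hfv, hmem⟩ := hp
    have heq := ccOf_eq hmem
    obtain ⟨e', he'⟩ := hZ.1
    have hbase' : BasedOn T v₀ Z (XvY T G v₀ Z v) :=
      ⟨hZ, e', he', mem_BCT hZ st.hT _ (hperi Z v hZ hv hfv)⟩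
    have hZY : YS' = Z := by
      rcases eq_of_ccRel st hinf hmem with h | ⟨_, _, h⟩
      · rw [← h] at hbase'
        exact basedOn_unique st hinf hNB hbase hbase'
      · exact h _ _ hbase hbase'
    subst hZY
    rcases exists_two_boundary st.hT st.hact st.hmin hY hu hYS' with hb | hb
    · refine Or.inr ⟨v, hv, hb, heq, ?_⟩
      rw [heq]
      exact hΦ.2.1 YS' v hYS' hv hfv hb
    · left
      rw [heq]
      exact hΦ.2.2 YS' v hYS' hv hfv hb
  · left
    refine hΦ.1 _ _ ⟨_, hNB, rfl⟩ hYS' ⟨XS G v₀ S', ?_, K, ⟨e, he, hK⟩, hKX⟩ hp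
    exact Relation.EqvGen.refl _

end AILemmas

end SSRN
namespace SSRN

section PeriLemmas
variable {G V : Type*} [Group G] [MulAction G V] {T : SimpleGraph V} {E : Set (Subgroup G)}

theorem self_mem_peri {Y : Set (Sym2 V)} {u : V} : u ∈ periForest T Y u :=
  ⟨.nil, by simp, by simp⟩

theorem mem_peri_of_walk {Y : Set (Sym2 V)} {u w : V} (p : T.Walk u w)
    (hp : ∀ e ∈ Y, u ∈ e → e ∉ p.edges) : w ∈ periForest T Y u := by
  classical
  exact ⟨p.bypass, p.bypass_isPath, fun e he hu hc => hp e he hu (p.edges_bypass_subset hc)⟩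

theorem cobdry_peri {Y : Set (Sym2 V)} {u : V} :
    cobdry T (periForest T Y u) ⊆ {e | e ∈ Y ∧ u ∈ e} := by
  rintro _ ⟨hf, a, b, rfl, ⟨p, hp, hpY⟩, hb⟩
  by_contra hc
  apply hb
  have hab : T.Adj a b := hf
  refine mem_peri_of_walk (p.concat hab) fun e he hu hm => ?_
  rw [SimpleGraph.Walk.edges_concat, List.concat_eq_append, List.mem_append] at hm
  rcases hm with hm | hm
  · exact hpY e he hu hm
  · rw [List.mem_singleton] at hm
    subst hm
    exact hc ⟨he, hu⟩

theorem peri_special {Y : Set (Sym2 V)} {u : V} (hval : FiniteValenceIn Y u) :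
    IsSpecialForest T (periForest T Y u) Y :=
  ⟨hval.subset cobdry_peri, fun _ he => (cobdry_peri he).1⟩

theorem peri_verts (st : Setup T E) {Y : Set (Sym2 V)} (hY : IsCylinder T G Y) {u : V}
    (hu : u ∈ cylVerts Y) {w : V} (hw : w ∈ periForest T Y u) (hwY : w ∈ cylVerts Y) :
    w = u := by
  obtain ⟨p, hp, hpY⟩ := hw
  have hc := cyl_convex st.hT st.hact st.hinv st.hE st.hET hY hu hwY p hp
  cases p with
  | nil => rfl
  | @cons _ y _ h q =>
    have hm : s(u, y) ∈ (SimpleGraph.Walk.cons h q).edges := by simp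
    exact absurd hm (hpY _ (hc _ hm) (Sym2.mem_mk_left _ _))

theorem peri_path (st : Setup T E) {Y : Set (Sym2 V)} (hY : IsCylinder T G Y) {u : V}
    (hu : u ∈ cylVerts Y) {w : V} (hw : w ∈ periForest T Y u) :
    ∃ p : T.Walk u w, ∀ f ∈ p.edges, f ∉ Y := by
  classical
  obtain ⟨p, hp, hpY⟩ := hw
  have hsup : ∀ x ∈ p.support, x ∈ periForest T Y u := fun x hx =>
    mem_peri_of_walk (p.takeUntil x hx) fun e he hue hm =>
      hpY e he hue (p.edges_takeUntil_subset hx hm)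
  refine ⟨p, fun f hf hfY => ?_⟩
  induction f using Sym2.ind with
  | _ x y =>
    have hx := peri_verts st hY hu (hsup x (p.fst_mem_support_of_mem_edges hf))
      ⟨_, hfY, by simp⟩
    have hy := peri_verts st hY hu (hsup y (p.snd_mem_support_of_mem_edges hf))
      ⟨_, hfY, by simp⟩
    have hadj : T.Adj x y := hY.2.1 hfY
    exact hadj.ne (hx.trans hy.symm)

theorem exists_cobdry_edge (hT : T.IsTree) {S : Set V} (h : NontrivForest S) :
    ∃ a b, a ∈ S ∧ b ∉ S ∧ s(a, b) ∈ cobdry T S := by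
  obtain ⟨x, hx⟩ := Set.Infinite.nonempty h.1
  obtain ⟨y, hy⟩ := Set.Infinite.nonempty h.2
  obtain ⟨p⟩ := hT.connected x y
  obtain ⟨f, -, hf⟩ := exists_edge_of_walk p (S := S) (fun hc => hy (hc.1 hx))
  obtain ⟨h1, a, b, rfl, ha, hb⟩ := id hf
  exact ⟨a, b, ha, hb, hf⟩

/-! ### Part 1 -/

/-- `x` is joined to `u_c` away from `Y`. -/
def Reach (G : Type*) [Group G] [MulAction G V] (T : SimpleGraph V) (Y : Set (Sym2 V)) (u : V)
    (x : TcSubV V) : Prop :=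
  ∃ p : (TcSub T G).Walk (tcv u) x, ∀ z ∈ p.support, z ≠ tcY Y ∧ ∀ w, z ≠ tcMid w Y

theorem tcv_ne_tcY {v : V} {Z : Set (Sym2 V)} : tcv v ≠ tcY Z := by
  intro h; cases h

theorem tcv_ne_tcMid {v w : V} {Z : Set (Sym2 V)} : tcv v ≠ tcMid w Z := by
  intro h; cases h

theorem tcY_ne_tcMid {w : V} {Z Z' : Set (Sym2 V)} : tcY Z ≠ tcMid w Z' := by
  intro h; cases h

theorem tcv_inj {v w : V} (h : tcv v = tcv w) : v = w := Sum.inl.inj h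

theorem tcY_inj {Z Z' : Set (Sym2 V)} (h : tcY Z = tcY Z') : Z = Z' :=
  Sum.inl.inj (Sum.inr.inj h)

theorem tcMid_inj {v w : V} {Z Z' : Set (Sym2 V)} (h : tcMid v Z = tcMid w Z') :
    v = w ∧ Z = Z' :=
  Prod.mk.inj (Sum.inr.inj (Sum.inr.inj h))

theorem adj_v_mid {v : V} {Z : Set (Sym2 V)} (h : MidOK T G v Z) :
    (TcSub T G).Adj (tcv v) (tcMid v Z) :=
  ⟨tcv_ne_tcMid, Or.inl (Or.inl ⟨v, Z, h, rfl, rfl⟩)⟩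

theorem adj_Y_mid {v : V} {Z : Set (Sym2 V)} (h : MidOK T G v Z) :
    (TcSub T G).Adj (tcY Z) (tcMid v Z) :=
  ⟨tcY_ne_tcMid, Or.inl (Or.inr ⟨v, Z, h, rfl, rfl⟩)⟩

theorem Reach.step {Y : Set (Sym2 V)} {u : V} {x y : TcSubV V} (h : Reach G T Y u x)
    (hxy : (TcSub T G).Adj x y) (hy : y ≠ tcY Y) (hy' : ∀ w, y ≠ tcMid w Y) :
    Reach G T Y u y := by
  obtain ⟨p, hp⟩ := h
  refine ⟨p.concat hxy, fun z hz => ?_⟩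
  rw [SimpleGraph.Walk.support_concat, List.mem_append,
    List.mem_singleton] at hz
  rcases hz with hz | rfl
  · exact hp z hz
  · exact ⟨hy, hy'⟩

theorem Reach.v_mid {Y Z : Set (Sym2 V)} {u v : V} (h : Reach G T Y u (tcv v))
    (hm : MidOK T G v Z) (hZ : Z ≠ Y) : Reach G T Y u (tcMid v Z) :=
  h.step (adj_v_mid hm) (Ne.symm tcY_ne_tcMid) fun _ hc => hZ (tcMid_inj hc).2

theorem Reach.Y_mid {Y Z : Set (Sym2 V)} {u v : V} (h : Reach G T Y u (tcY Z))
    (hm : MidOK T G v Z) (hZ : Z ≠ Y) : Reach G T Y u (tcMid v Z) :=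
  h.step (adj_Y_mid hm) (Ne.symm tcY_ne_tcMid) fun _ hc => hZ (tcMid_inj hc).2

theorem Reach.v_Y {Y Z : Set (Sym2 V)} {u v : V} (h : Reach G T Y u (tcv v))
    (hm : MidOK T G v Z) (hZ : Z ≠ Y) : Reach G T Y u (tcY Z) :=
  (h.v_mid hm hZ).step (adj_Y_mid hm).symm (fun hc => hZ (tcY_inj hc)) fun _ => tcY_ne_tcMid

theorem Reach.Y_v {Y Z : Set (Sym2 V)} {u v : V} (h : Reach G T Y u (tcY Z))
    (hm : MidOK T G v Z) (hZ : Z ≠ Y) : Reach G T Y u (tcv v) :=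
  (h.Y_mid hm hZ).step (adj_v_mid hm).symm tcv_ne_tcY fun _ => tcv_ne_tcMid

theorem Reach.hop {Y Z Z' : Set (Sym2 V)} {u v : V} (h : Reach G T Y u (tcY Z))
    (hZ : IsCylinder T G Z) (hZ' : IsCylinder T G Z') (hZY : Z ≠ Y) (hZY' : Z' ≠ Y)
    (hv : v ∈ cylVerts Z) (hv' : v ∈ cylVerts Z') : Reach G T Y u (tcY Z') := by
  by_cases hne : Z = Z'
  · rwa [← hne]
  · have h1 : v ∈ cylBoundary T Z := by
      obtain ⟨e, he, hve⟩ := hv'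
      exact ⟨hv, e, hZ'.2.1 he, hve, fun hc => hne (hZ.eq_of_mem hZ' hc he)⟩
    have h2 := boundary_of_two hZ hZ' h1 hv'
    exact (h.Y_v ⟨hZ, h1⟩ hZY).v_Y ⟨hZ', h2⟩ hZY'

theorem Reach.walk {Y : Set (Sym2 V)} {u : V} {a b : V} (p : T.Walk a b)
    (hp : ∀ f ∈ p.edges, f ∉ Y) : ∀ {Z Z' : Set (Sym2 V)} (_ : Reach G T Y u (tcY Z))
    (_ : IsCylinder T G Z) (_ : IsCylinder T G Z') (_ : Z ≠ Y) (_ : Z' ≠ Y)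
    (_ : a ∈ cylVerts Z) (_ : b ∈ cylVerts Z'), Reach G T Y u (tcY Z') := by
  induction p with
  | nil => exact fun h hZ hZ' hZY hZY' ha hb => h.hop hZ hZ' hZY hZY' ha hb
  | @cons a c b hac q ih =>
    intro Z Z' h hZ hZ' hZY hZY' ha hb
    obtain ⟨Z₁, hZ₁, hm⟩ := exists_cylinder (G := G) (T := T) (e := s(a, c)) hac
    have hne : Z₁ ≠ Y := fun hc => hp s(a, c) (by simp) (hc ▸ hm)
    have h1 := h.hop hZ hZ₁ hZY hne ha ⟨_, hm, by simp⟩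
    exact ih (fun f hf => hp f (by simp [hf])) h1 hZ₁ hZ' hne hZY' ⟨_, hm, by simp⟩ hb

theorem reach_main (st : Setup T E) {Y : Set (Sym2 V)} (hY : IsCylinder T G Y) {u : V}
    (hu : u ∈ cylBoundary T Y) {a : V} (ha : a ∈ periForest T Y u) {Z : Set (Sym2 V)}
    (hZ : IsCylinder T G Z) (hZY : Z ≠ Y) (haZ : a ∈ cylVerts Z) :
    Reach G T Y u (tcY Z) := by
  obtain ⟨p, hp⟩ := peri_path st hY hu.1 ha
  obtain ⟨-, e, he, hue, heY⟩ := id hu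
  obtain ⟨Z₀, hZ₀, hm⟩ := exists_cylinder (G := G) he
  have hne : Z₀ ≠ Y := fun hc => heY (hc ▸ hm)
  have h0 : Reach G T Y u (tcv u) := by
    refine ⟨.nil, fun z hz => ?_⟩
    rw [SimpleGraph.Walk.support_nil, List.mem_singleton] at hz
    subst hz
    exact ⟨tcv_ne_tcY, fun _ => tcv_ne_tcMid⟩
  have hv : u ∈ cylVerts Z₀ := ⟨e, hm, hue⟩
  have h1 := h0.v_Y ⟨hZ₀, boundary_of_two hY hZ₀ hu hv⟩ hne
  exact Reach.walk p hp h1 hZ₀ hZ hne hZY hv haZ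

theorem eq_peri_of_subset (st : Setup T E) {Y : Set (Sym2 V)} (hY : IsCylinder T G Y) {u : V}
    (hu : u ∈ cylBoundary T Y) {S' : Set V} (hS' : IsSpecialForest T S' Y)
    (hnt : NontrivForest S') (hsub : S' ⊆ periForest T Y u) : S' = periForest T Y u := by
  have key : ∀ x ∈ periForest T Y u, (u ∈ S' ↔ x ∈ S') := by
    intro x hx
    obtain ⟨p, hp⟩ := peri_path st hY hu.1 hx
    exact mem_iff_of_walk p fun f hf hc => hp f hf (hS'.2 hc)
  obtain ⟨x, hx⟩ := Set.Infinite.nonempty hnt.1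
  have huS := (key x (hsub hx)).2 hx
  exact Set.Subset.antisymm hsub fun y hy => (key y hy).1 huS

/-! ### Part 2 -/

/-- The part of `T_c` on the side of `u_c`. -/
def sideSet (T : SimpleGraph V) (Y : Set (Sym2 V)) (u : V) : Set (TcSubV V) :=
  {x | (∃ w ∈ periForest T Y u, x = tcv w) ∨
    (∃ Z : Set (Sym2 V), cylVerts Z ⊆ periForest T Y u ∧ x = tcY Z) ∨
    (∃ (w : V) (Z : Set (Sym2 V)), cylVerts Z ⊆ periForest T Y u ∧ x = tcMid w Z) ∨
    x = tcMid u Y}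

theorem side_step (st : Setup T E) {Y : Set (Sym2 V)} (hY : IsCylinder T G Y) {u : V}
    (hu : u ∈ cylBoundary T Y) {φ : TcSubV V} (hφ : φ = tcMid u Y ∨ φ = tcY Y)
    {x y : TcSubV V} (hx : x ∈ sideSet T Y u) (hxy : (TcSub T G).Adj x y) (hxφ : x ≠ φ)
    (hyφ : y ≠ φ) : y ∈ sideSet T Y u := by
  obtain ⟨-, (⟨v, Z, hm, rfl, rfl⟩ | ⟨v, Z, hm, rfl, rfl⟩) |
    (⟨v, Z, hm, rfl, rfl⟩ | ⟨v, Z, hm, rfl, rfl⟩)⟩ := hxy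
  · rcases hx with ⟨w, hw, h⟩ | ⟨Z', hZ', h⟩ | ⟨w, Z', hZ', h⟩ | h
    · obtain rfl := tcv_inj h
      by_cases hZY : Z = Y
      · subst hZY
        rw [peri_verts st hY hu.1 hw hm.2.1]
        exact Or.inr (Or.inr (Or.inr rfl))
      · refine Or.inr (Or.inr (Or.inl ⟨v, Z, fun z hz => ?_, rfl⟩))
        refine (cylVerts_side st.hT st.hact st.hinv st.hE st.hET hm.1 (fun f hf hc => ?_)
          hm.2.1 hz).1 hw
        exact hZY (hm.1.eq_of_mem hY hf (cobdry_peri hc).1)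
    · exact absurd h tcv_ne_tcY
    · exact absurd h tcv_ne_tcMid
    · exact absurd h tcv_ne_tcMid
  · rcases hx with ⟨w, hw, h⟩ | ⟨Z', hZ', h⟩ | ⟨w, Z', hZ', h⟩ | h
    · exact absurd h.symm tcv_ne_tcY
    · obtain rfl := tcY_inj h
      exact Or.inr (Or.inr (Or.inl ⟨v, Z, hZ', rfl⟩))
    · exact absurd h tcY_ne_tcMid
    · exact absurd h tcY_ne_tcMid
  · rcases hx with ⟨w, hw, h⟩ | ⟨Z', hZ', h⟩ | ⟨w, Z', hZ', h⟩ | h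
    · exact absurd h.symm tcv_ne_tcMid
    · exact absurd h.symm tcY_ne_tcMid
    · obtain ⟨rfl, rfl⟩ := tcMid_inj h
      exact Or.inl ⟨v, hZ' hm.2.1, rfl⟩
    · obtain ⟨rfl, rfl⟩ := tcMid_inj h
      exact Or.inl ⟨v, self_mem_peri, rfl⟩
  · rcases hx with ⟨w, hw, h⟩ | ⟨Z', hZ', h⟩ | ⟨w, Z', hZ', h⟩ | h
    · exact absurd h.symm tcv_ne_tcMid
    · exact absurd h.symm tcY_ne_tcMid
    · obtain ⟨rfl, rfl⟩ := tcMid_inj h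
      exact Or.inr (Or.inl ⟨Z, hZ', rfl⟩)
    · obtain ⟨rfl, rfl⟩ := tcMid_inj h
      rcases hφ with rfl | rfl
      · exact absurd rfl hxφ
      · exact absurd rfl hyφ

theorem side_walk (st : Setup T E) {Y : Set (Sym2 V)} (hY : IsCylinder T G Y) {u : V}
    (hu : u ∈ cylBoundary T Y) {φ : TcSubV V} (hφ : φ = tcMid u Y ∨ φ = tcY Y)
    {x y : TcSubV V} (p : (TcSub T G).Walk x y) (hx : x ∈ sideSet T Y u) (hp : φ ∉ p.support) :
    y ∈ sideSet T Y u := by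
  induction p with
  | nil => exact hx
  | @cons x z y hxz q ih =>
    rw [SimpleGraph.Walk.support_cons, List.mem_cons, not_or] at hp
    refine ih (side_step st hY hu hφ hx hxz (Ne.symm hp.1) ?_) hp.2
    rintro rfl
    exact hp.2 q.start_mem_support

theorem eq_peri_of_superset (st : Setup T E) {Y : Set (Sym2 V)} (hY : IsCylinder T G Y) {u : V}
    (hu : u ∈ cylBoundary T Y) (h2 : TwoBoundary T Y) {S' : Set V} (hS' : IsSpecialForest T S' Y)
    (hnt : NontrivForest S') (hsub : periForest T Y u ⊆ S') : S' = periForest T Y u := by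
  have hb : ∃ b, ∀ e ∈ Y, e = s(u, b) := by
    obtain ⟨a, b, -, hab⟩ := h2
    have h1 := cyl_of_two st.hT st.hact st.hmin st.hval3 hY hab
    have hu' := hu
    rw [hab] at hu'
    rcases hu' with rfl | rfl
    · exact ⟨b, h1⟩
    · exact ⟨a, fun e he => (h1 e he).trans Sym2.eq_swap⟩
  obtain ⟨b, hb⟩ := hb
  have key : ∀ x, x ∉ periForest T Y u → (b ∈ S' ↔ x ∈ S') := by
    intro x hx
    obtain ⟨p, hp⟩ := (st.hT.existsUnique_path u x).exists
    obtain ⟨f, hf, hfc⟩ := exists_edge_of_walk p (S := periForest T Y u)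
      (fun hc => hx (hc.1 self_mem_peri))
    have hfe := hb f (cobdry_peri hfc).1
    subst hfe
    cases p with
    | nil => simp at hf
    | @cons _ c _ huc q =>
      rw [SimpleGraph.Walk.cons_isPath_iff] at hp
      rw [SimpleGraph.Walk.edges_cons, List.mem_cons] at hf
      rcases hf with hf | hf
      · have hbc : b = c := by
          rw [Sym2.eq_iff] at hf
          rcases hf with h | h
          · exact h.2
          · exact h.2.trans h.1
        subst hbc
        refine mem_iff_of_walk q fun f hf hc => hp.2 ?_
        have := hb f (hS'.2 hc)
        subst this
        exact q.fst_mem_support_of_mem_edges hf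
      · exact absurd (q.fst_mem_support_of_mem_edges hf) hp.2
  by_contra hne
  have hex : ∃ x ∈ S', x ∉ periForest T Y u := by
    by_contra! hc
    exact hne (Set.Subset.antisymm hc hsub)
  obtain ⟨x, hx, hxS⟩ := hex
  have hbS := (key x hxS).2 hx
  obtain ⟨y, hy⟩ := Set.Infinite.nonempty hnt.2
  by_cases hyS : y ∈ periForest T Y u
  · exact hy (hsub hyS)
  · exact hy ((key y hyS).1 hbS)

end PeriLemmas

end SSRN
namespace SSRN

/-- Lemma 3.8. Let `S = S_{u,Y}` be peripheral and `S'` a non-trivial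
special forest with `[[S']] ≠ [[S]]`. If `S' ⊆ S` then `Φ([[S']])` lies in the component of
`T_c ∖ {Φ([[S]])}` containing `u_c`; if `S ⊆ S'` it lies in the component not
containing `u_c`. -/
theorem stmt_15 {G V : Type*} [Group G] [MulAction G V]
    (hGfg : Group.FG G)
    (T : SimpleGraph V) (hT : T.IsTree) (hact : ActsOn T G) (hinv : NoInversions T G)
    (E : Set (Subgroup G)) (hE : Admissible E) (hET : IsETree T G E)
    (hmin : MinimalAction T G) (v₀ : V)
    (hmany : ∃ Y₁ Y₂ : Set (Sym2 V), IsCylinder T G Y₁ ∧ IsCylinder T G Y₂ ∧ Y₁ ≠ Y₂)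
    (hval3 : ∀ w : V, ∃ a b c : V, a ≠ b ∧ a ≠ c ∧ b ≠ c ∧ T.Adj w a ∧ T.Adj w b ∧ T.Adj w c)
    (Y : Set (Sym2 V)) (hY : IsCylinder T G Y)
    (u : V) (hu : u ∈ cylBoundary T Y) (hval : FiniteValenceIn Y u)
    (S' : Set V) (YS' : Set (Sym2 V)) (hYS' : IsCylinder T G YS')
    (hS' : IsSpecialForest T S' YS') (hS'nt : NontrivForest S')
    (hne : ccOf T G v₀ (XS G v₀ S') ≠ ccOf T G v₀ (XvY T G v₀ Y u)) :
    -- (1) if `S' ⊆ S`, `Φ([[S']])` is in the component of `T_c ∖ {Φ([[S]])}` containing `u_c`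
    (S' ⊆ periForest T Y u →
      ∀ Φ : Set (Set G) → TcSubV V, PhiSpec T G v₀ Φ →
        ∃ p : (TcSub T G).Walk (tcv u) (Φ (ccOf T G v₀ (XS G v₀ S'))),
          Φ (ccOf T G v₀ (XvY T G v₀ Y u)) ∉ p.support) ∧
    -- (2) if `S ⊆ S'`, `Φ([[S']])` is in the component of `T_c ∖ {Φ([[S]])}` not
    -- containing `u_c`
    (periForest T Y u ⊆ S' →
      ∀ Φ : Set (Set G) → TcSubV V, PhiSpec T G v₀ Φ →
        Φ (ccOf T G v₀ (XS G v₀ S')) ≠ Φ (ccOf T G v₀ (XvY T G v₀ Y u)) ∧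
        ¬ ∃ p : (TcSub T G).Walk (tcv u) (Φ (ccOf T G v₀ (XS G v₀ S'))),
            Φ (ccOf T G v₀ (XvY T G v₀ Y u)) ∉ p.support) := by
  have st : Setup T E := ⟨hT, hact, hinv, hE, hET, hmin, hval3⟩
  have hperi : ∀ (Z : Set (Sym2 V)) (v : V), IsCylinder T G Z → v ∈ cylBoundary T Z →
      FiniteValenceIn Z v → IsSpecialForest T (periForest T Z v) Z :=
    fun Z v _ _ hv => peri_special hv
  have hne' : S' ≠ periForest T Y u := fun h => hne (by rw [h]; rfl)
  obtain ⟨a, b, ha, hb, hab⟩ := exists_cobdry_edge hT hS'nt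
  have haY : a ∈ cylVerts YS' := ⟨_, hS'.2 hab, by simp⟩
  have hbY : b ∈ cylVerts YS' := ⟨_, hS'.2 hab, by simp⟩
  have hφ : ∀ Φ : Set (Set G) → TcSubV V, PhiSpec T G v₀ Φ →
      (Φ (ccOf T G v₀ (XvY T G v₀ Y u)) = tcMid u Y) ∨
      (TwoBoundary T Y ∧ Φ (ccOf T G v₀ (XvY T G v₀ Y u)) = tcY Y) := by
    intro Φ hΦ
    rcases exists_two_boundary hT hact hmin hY hu hY with h | h
    · exact Or.inl (hΦ.2.1 Y u hY hu hval h)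
    · exact Or.inr ⟨h, hΦ.2.2 Y u hY hu hval h⟩
  constructor
  · intro hsub Φ hΦ
    have hYne : YS' ≠ Y := by
      rintro rfl
      exact hne' (eq_peri_of_subset st hY hu hS' hS'nt hsub)
    have hr := reach_main st hY hu (hsub ha) hYS' hYne haY
    have hr' : Reach G T Y u (Φ (ccOf T G v₀ (XS G v₀ S'))) := by
      rcases phi_value st hY hu hYS' hS' hS'nt hΦ hperi with h | ⟨v, hv, -, -, h⟩
      · rw [h]; exact hr
      · rw [h]; exact hr.Y_mid ⟨hYS', hv⟩ hYne
    obtain ⟨p, hp⟩ := hr'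
    refine ⟨p, fun hc => ?_⟩
    rcases hφ Φ hΦ with h | ⟨-, h⟩
    · exact (hp _ hc).2 u h
    · exact (hp _ hc).1 h
  · intro hsub Φ hΦ
    have hnot : ¬ cylVerts YS' ⊆ periForest T Y u := fun h => hb (hsub (h hbY))
    have ht : Φ (ccOf T G v₀ (XS G v₀ S')) = tcY YS' ∨
        ∃ v, ¬ (v = u ∧ YS' = Y) ∧ Φ (ccOf T G v₀ (XS G v₀ S')) = tcMid v YS' := by
      rcases phi_value st hY hu hYS' hS' hS'nt hΦ hperi with h | ⟨v, -, -, heq, h⟩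
      · exact Or.inl h
      · refine Or.inr ⟨v, ?_, h⟩
        rintro ⟨rfl, rfl⟩
        exact hne heq
    constructor
    · rcases hφ Φ hΦ with h | ⟨h2, h⟩
      · rw [h]
        rcases ht with ht | ⟨v, hv, ht⟩
        · rw [ht]; exact tcY_ne_tcMid
        · rw [ht]; exact fun hc => hv (tcMid_inj hc)
      · rw [h]
        rcases ht with ht | ⟨v, hv, ht⟩
        · rw [ht]
          intro hc
          have hYY := tcY_inj hc
          subst hYY
          exact hne' (eq_peri_of_superset st hY hu h2 hS' hS'nt hsub)
        · rw [ht]; exact Ne.symm tcY_ne_tcMid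
    · rintro ⟨p, hp⟩
      have hmem := side_walk st hY hu ((hφ Φ hΦ).imp id And.right) p
        (Or.inl ⟨u, self_mem_peri, rfl⟩) hp
      rcases ht with ht | ⟨v, hv, ht⟩
      · rw [ht] at hmem
        rcases hmem with ⟨w, hw, h⟩ | ⟨Z', hZ', h⟩ | ⟨w, Z', hZ', h⟩ | h
        · exact tcv_ne_tcY h.symm
        · exact hnot (tcY_inj h ▸ hZ')
        · exact tcY_ne_tcMid h
        · exact tcY_ne_tcMid h
      · rw [ht] at hmem
        rcases hmem with ⟨w, hw, h⟩ | ⟨Z', hZ', h⟩ | ⟨w, Z', hZ', h⟩ | h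
        · exact tcv_ne_tcMid h.symm
        · exact tcY_ne_tcMid h.symm
        · exact hnot ((tcMid_inj h).2 ▸ hZ')
        · exact hv (tcMid_inj h)

end SSRN
end

section
/- Let G be a group, E an admissible family of subgroups of G, and let T and T' be E-trees such that T has finitely many G-orbits of edges. Let f : T → T' be a G-equivariant map sending every edge of T to a vertex or an edge of T'. Then for every edge e' of T', there are only finitely many edges e of T with f(e) = e'. -/
open scoped Pointwise symmDiff

namespace SSRN

theorem map_smul_mul {G V : Type*} [Group G] [MulAction G V] (a b : G) (e : Sym2 V) :
    Sym2.map ((a * b) • ·) e = Sym2.map (a • ·) (Sym2.map (b • ·) e) := by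
  rw [Sym2.map_map]
  congr 1
  funext v
  simp [mul_smul]

theorem orbit_finite {G V : Type*} [Group G] [MulAction G V] (e : Sym2 V) (K : Subgroup G)
    (h : (edgeStab G e).relIndex K ≠ 0) :
    {x : Sym2 V | ∃ k ∈ K, Sym2.map (k • ·) e = x}.Finite := by
  have hfin : Finite (K ⧸ (edgeStab G e).subgroupOf K) :=
    @Subgroup.finite_quotient_of_finiteIndex _ _ _ ⟨h⟩
  refine (Set.finite_range (fun q : K ⧸ (edgeStab G e).subgroupOf K =>
    Sym2.map ((q.out : G) • ·) e)).subset ?_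
  rintro x ⟨k, hk, rfl⟩
  refine ⟨QuotientGroup.mk (⟨k, hk⟩ : K), ?_⟩
  obtain ⟨⟨m, hm⟩, hm'⟩ := QuotientGroup.mk_out_eq_mul ((edgeStab G e).subgroupOf K) ⟨k, hk⟩
  have hms : Sym2.map ((m : G) • ·) e = e := hm
  simp only [hm', Subgroup.coe_mul, map_smul_mul, hms]


/-- If `T` has finitely many orbits of edges and `f : T → T'` is an
equivariant map between `E`-trees sending edges to vertices or edges, then every edge of
`T'` has finitely many preimage edges. -/
theorem stmt_19 {G V V' : Type*} [Group G] [MulAction G V] [MulAction G V']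
    (T : SimpleGraph V) (T' : SimpleGraph V') (hT : T.IsTree) (hT' : T'.IsTree)
    (hact : ActsOn T G) (hact' : ActsOn T' G)
    (hinv : NoInversions T G) (hinv' : NoInversions T' G)
    (E : Set (Subgroup G)) (hE : Admissible E)
    (hET : IsETree T G E) (hET' : IsETree T' G E)
    (hfo : FinEdgeOrbits T G)
    (f : V → V') (hequiv : ∀ (g : G) (x : V), f (g • x) = g • f x)
    (hmap : ∀ u v : V, T.Adj u v → (f u = f v ∨ T'.Adj (f u) (f v))) :
    ∀ e' ∈ T'.edgeSet, {e : Sym2 V | e ∈ T.edgeSet ∧ Sym2.map f e = e'}.Finite := by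
  intro e' he'
  have hmapf : ∀ (g : G) (e : Sym2 V),
      Sym2.map f (Sym2.map (g • ·) e) = Sym2.map (g • ·) (Sym2.map f e) := by
    intro g e
    rw [Sym2.map_map, Sym2.map_map]
    congr 1
    funext v
    exact hequiv g v
  obtain ⟨F, hF⟩ := hfo
  have key : ∀ e₀ ∈ F, {e : Sym2 V | (e ∈ T.edgeSet ∧ Sym2.map f e = e') ∧
      ∃ g : G, Sym2.map (g • ·) e₀ = e}.Finite := by
    intro e₀ _
    rcases Set.eq_empty_or_nonempty {e : Sym2 V | (e ∈ T.edgeSet ∧ Sym2.map f e = e') ∧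
      ∃ g : G, Sym2.map (g • ·) e₀ = e} with h0 | ⟨e₁, ⟨he₁, hf₁⟩, g₁, hg₁⟩
    · rw [h0]
      exact Set.finite_empty
    · have hle : edgeStab G e₁ ≤ edgeStab G e' := by
        intro g hg
        have hg' : Sym2.map (g • ·) e₁ = e₁ := hg
        show Sym2.map (g • ·) e' = e'
        rw [← hf₁, ← hmapf, hg']
      refine (orbit_finite e₁ (edgeStab G e')
        (hE.2.2 _ (hET e₁ he₁) _ (hET' e' he') hle)).subset ?_
      rintro e ⟨⟨he, hfe⟩, g, hg⟩
      have hge : Sym2.map ((g * g₁⁻¹) • ·) e₁ = e := by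
        rw [← hg₁, ← map_smul_mul, inv_mul_cancel_right, hg]
      refine ⟨g * g₁⁻¹, ?_, hge⟩
      show Sym2.map ((g * g₁⁻¹) • ·) e' = e'
      conv_lhs => rw [← hf₁]
      rw [← hmapf, hge, hfe]
  refine (F.finite_toSet.biUnion key).subset ?_
  rintro e ⟨he, hfe⟩
  obtain ⟨e₀, he₀, g, hg⟩ := hF e he
  exact Set.mem_biUnion he₀ ⟨⟨he, hfe⟩, g, hg⟩

end SSRN
end
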